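/- Let P ∈ ℝ^{n×n} be an ergodic row-stochastic Markov matrix with stationary distribution π, π_max = max_i π_i, π_min = min_i π_i, and τ_* = τ(1/4) its 1/4-mixing time. Let X_0, ..., X_N be a trajectory of the chain and define the empirical transition matrix P̂_0 by P̂_0(i,j) = (Σ_{t=1}^N 1{X_{t−1}=i, X_t=j}) / (Σ_{t=1}^N 1{X_{t−1}=i}) when the denominator is nonzero, and P̂_0(i,j) = 1/n otherwise. Then for any ε > 0, setting ε̃ = min{π_min/2, ε}, one has Prob(‖P̂_0 − P‖ ≤ 4 π_min^{-1} ‖P‖ ε) ≥ 1 − 24 n τ_* log(ε̃^{-1}) exp(−N / (100 τ_* π_max log(ε̃^{-1}) ε̃^{-2})), where ‖·‖ is the spectral norm. -/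

import Mathlib

open scoped BigOperators
open Matrix

noncomputable section

namespace MJ

/-- Euclidean (ℓ2) norm of a finite vector. -/
def l2 {k : ℕ} (v : Fin k → ℝ) : ℝ := Real.sqrt (∑ j, v j ^ 2)

/-- ℓ1 norm of a finite vector. -/
def l1 {k : ℕ} (v : Fin k → ℝ) : ℝ := ∑ i, |v i|

/-- Maximum absolute row sum (matrix ∞-norm). -/
def rowSumNorm {m k : ℕ} (A : Matrix (Fin m) (Fin k) ℝ) : ℝ := ⨆ i, ∑ j, |A i j|

/-- Frobenius norm. -/
def frob {m k : ℕ} (A : Matrix (Fin m) (Fin k) ℝ) : ℝ := Real.sqrt (∑ i, ∑ j, A i j ^ 2)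

/-- Spectral norm (ℓ2 operator norm). -/
def spec {m k : ℕ} (A : Matrix (Fin m) (Fin k) ℝ) : ℝ :=
  sSup {c : ℝ | ∃ x : Fin k → ℝ, l2 x ≤ 1 ∧ c = l2 (A.mulVec x)}

/-- `i`-th largest singular value (1-indexed), via Courant–Fischer max-min. -/
def singVal {m k : ℕ} (A : Matrix (Fin m) (Fin k) ℝ) (i : ℕ) : ℝ :=
  sSup {c : ℝ | ∃ V : Submodule ℝ (Fin k → ℝ), Module.finrank ℝ V = i ∧
    ∀ x ∈ V, c * l2 x ≤ l2 (A.mulVec x)}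

/-- Row-stochastic matrix. -/
def RowStochastic {k : ℕ} (P : Matrix (Fin k) (Fin k) ℝ) : Prop :=
  (∀ i j, 0 ≤ P i j) ∧ ∀ i, ∑ j, P i j = 1

/-- Probability vector. -/
def IsProbVec {k : ℕ} (v : Fin k → ℝ) : Prop := (∀ i, 0 ≤ v i) ∧ ∑ i, v i = 1

/-- Stationary distribution: a probability vector with πᵀ P = πᵀ. -/
def IsStationary {k : ℕ} (P : Matrix (Fin k) (Fin k) ℝ) (piv : Fin k → ℝ) : Prop :=
  IsProbVec piv ∧ ∀ j, ∑ i, piv i * P i j = piv j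

/-- Ergodicity (irreducible + aperiodic ⟺ primitive for finite chains). -/
def Ergodic' {k : ℕ} (P : Matrix (Fin k) (Fin k) ℝ) : Prop :=
  ∃ t : ℕ, ∀ i j, 0 < (P ^ t) i j

/-- ε-mixing time: τ(ε) = min{t : max_i (1/2)‖(P^t)(i,:) − π‖₁ ≤ ε}. -/
def mixingTime {k : ℕ} (P : Matrix (Fin k) (Fin k) ℝ) (piv : Fin k → ℝ) (ε : ℝ) : ℕ :=
  sInf {t : ℕ | ∀ i, (1/2) * ∑ j, |(P ^ t) i j - piv j| ≤ ε}

/-- Full SVD decomposition predicate: A = U S Vᵀ with U, V orthogonal and S diagonal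
with nonnegative entries arranged in descending order. -/
def IsSVD {m k : ℕ} (A : Matrix (Fin m) (Fin k) ℝ) (U : Matrix (Fin m) (Fin m) ℝ)
    (S : Matrix (Fin m) (Fin k) ℝ) (V : Matrix (Fin k) (Fin k) ℝ) : Prop :=
  Uᵀ * U = 1 ∧ Vᵀ * V = 1 ∧ A = U * S * Vᵀ ∧
  (∀ (i : Fin m) (j : Fin k), (i : ℕ) ≠ (j : ℕ) → S i j = 0) ∧
  (∀ i j, 0 ≤ S i j) ∧
  (∀ (a b : ℕ) (ham : a < m) (hak : a < k) (hbm : b < m) (hbk : b < k),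
    a ≤ b → S ⟨b, hbm⟩ ⟨b, hbk⟩ ≤ S ⟨a, ham⟩ ⟨a, hak⟩)

/-- `Ur` consists of the first `r` left singular vectors of `A`. -/
def IsLeftSingTrunc {m k : ℕ} (A : Matrix (Fin m) (Fin k) ℝ) (r : ℕ)
    (Ur : Matrix (Fin m) (Fin r) ℝ) : Prop :=
  ∃ U S V, IsSVD A U S V ∧ ∃ h : r ≤ m, ∀ (i : Fin m) (j : Fin r),
    Ur i j = U i ⟨(j : ℕ), lt_of_lt_of_le j.isLt h⟩

/-- `Vr` consists of the first `r` right singular vectors of `A`. -/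
def IsRightSingTrunc {m k : ℕ} (A : Matrix (Fin m) (Fin k) ℝ) (r : ℕ)
    (Vr : Matrix (Fin k) (Fin r) ℝ) : Prop :=
  IsLeftSingTrunc Aᵀ r Vr

/-- The matrix (I − EEᵀ)(FFᵀ), whose spectral/Frobenius norm is the sinΘ distance
between the column spaces of `E` and `F` (for `E`, `F` with orthonormal columns). -/
def sinThetaMat {k r : ℕ} (E F : Matrix (Fin k) (Fin r) ℝ) : Matrix (Fin k) (Fin k) ℝ :=
  (1 - E * Eᵀ) * (F * Fᵀ)

/-- Membership matrix: each row has exactly one entry 1 and all others 0. -/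
def IsMembership {k r : ℕ} (M : Matrix (Fin k) (Fin r) ℝ) : Prop :=
  ∀ i, ∃ j, M i j = 1 ∧ ∀ j', j' ≠ j → M i j' = 0

/-- A family of finsets forming a partition of `Fin k`. -/
def IsPartition {k r : ℕ} (Ω : Fin r → Finset (Fin k)) : Prop :=
  (∀ a b, a ≠ b → Disjoint (Ω a) (Ω b)) ∧ Finset.univ.biUnion Ω = Finset.univ

/-- `P` is aggregatable w.r.t. partition `Ω`: rows within the same cluster coincide. -/
def Aggregatable {k r : ℕ} (P : Matrix (Fin k) (Fin k) ℝ) (Ω : Fin r → Finset (Fin k)) : Prop :=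
  ∀ s, ∀ i ∈ Ω s, ∀ j ∈ Ω s, ∀ c, P i c = P j c

/-- Misclustering rate: min over bijections of the relative misclustering counts. -/
def MR {k r : ℕ} (Ω Ωh : Fin r → Finset (Fin k)) : ℝ :=
  ⨅ σ : Equiv.Perm (Fin r), ∑ j, (((Ω j) \ (Ωh (σ j))).card : ℝ) / ((Ω j).card : ℝ)

/-- k-means objective on the rows of `U`. -/
def kmeansObj {k r : ℕ} (U : Matrix (Fin k) (Fin r) ℝ) (Ωh : Fin r → Finset (Fin k))
    (c : Fin r → Fin r → ℝ) : ℝ :=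
  ∑ s, ∑ i ∈ Ωh s, ∑ j, (U i j - c s j) ^ 2

/-- Optimal value of the k-means problem on the rows of `U`. -/
def kmeansOpt {k r : ℕ} (U : Matrix (Fin k) (Fin r) ℝ) : ℝ :=
  sInf {v : ℝ | ∃ Ωh c, IsPartition Ωh ∧ v = kmeansObj U Ωh c}

/-- A (1+ε) approximate solution of the k-means problem on the rows of `U`. -/
def IsApproxKMeans {k r : ℕ} (U : Matrix (Fin k) (Fin r) ℝ) (ε : ℝ)
    (Ωh : Fin r → Finset (Fin k)) (c : Fin r → Fin r → ℝ) : Prop :=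
  IsPartition Ωh ∧ kmeansObj U Ωh c ≤ (1 + ε) * kmeansOpt U

/-- Optimal value of the k-means problem in membership-matrix form. -/
def kmeansOptM {k r : ℕ} (U : Matrix (Fin k) (Fin r) ℝ) : ℝ :=
  sInf {v : ℝ | ∃ (M : Matrix (Fin k) (Fin r) ℝ) (C : Matrix (Fin r) (Fin r) ℝ),
    IsMembership M ∧ v = frob (M * C - U) ^ 2}

/-- Number of t ∈ {1,…,N} with x_{t−1} = i. -/
def countState {k N : ℕ} (x : Fin (N+1) → Fin k) (i : Fin k) : ℕ :=
  (Finset.univ.filter fun t : Fin N => x t.castSucc = i).card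

/-- Number of t ∈ {1,…,N} with x_{t−1} = i and x_t = j. -/
def countTrans {k N : ℕ} (x : Fin (N+1) → Fin k) (i j : Fin k) : ℕ :=
  (Finset.univ.filter fun t : Fin N => x t.castSucc = i ∧ x t.succ = j).card

/-- Empirical state distribution. -/
def empPi {k N : ℕ} (x : Fin (N+1) → Fin k) (i : Fin k) : ℝ :=
  (countState x i : ℝ) / (N : ℝ)

/-- Empirical frequency matrix. -/
def empF {k N : ℕ} (x : Fin (N+1) → Fin k) : Matrix (Fin k) (Fin k) ℝ :=
  Matrix.of fun i j => (countTrans x i j : ℝ) / (N : ℝ)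

/-- Empirical transition matrix (uniform row if a state never occurs). -/
def empMatrix {k N : ℕ} (x : Fin (N+1) → Fin k) : Matrix (Fin k) (Fin k) ℝ :=
  Matrix.of fun i j =>
    if countState x i = 0 then 1 / (k : ℝ)
    else (countTrans x i j : ℝ) / (countState x i : ℝ)

/-- Probability weight of a finite Markov-chain path with initial distribution `pi0`. -/
def pathWeight {k : ℕ} (N : ℕ) (P : Matrix (Fin k) (Fin k) ℝ) (pi0 : Fin k → ℝ)
    (x : Fin (N+1) → Fin k) : ℝ :=
  pi0 (x 0) * ∏ t : Fin N, P (x t.castSucc) (x t.succ)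

/-- Probability of an event over Markov-chain trajectories of length N+1. -/
def pathProb {k : ℕ} (N : ℕ) (P : Matrix (Fin k) (Fin k) ℝ) (pi0 : Fin k → ℝ)
    (E : Set ((Fin (N+1)) → Fin k)) : ℝ :=
  ∑ x : Fin (N+1) → Fin k, E.indicator (pathWeight N P pi0) x

end MJ

namespace MJaux
set_option linter.unusedSectionVars false
open Matrix NormedSpace Filter Topology

section trotter
variable {𝔸 : Type*} [NormedRing 𝔸] [NormedAlgebra ℝ 𝔸] [CompleteSpace 𝔸] [NormOneClass 𝔸]

lemma norm_exp_le_exp_norm (x : 𝔸) : ‖NormedSpace.exp x‖ ≤ Real.exp ‖x‖ := by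
  have h1 : NormedSpace.exp x = ∑' n : ℕ, ((n.factorial : ℝ)⁻¹) • x ^ n := by
    rw [NormedSpace.exp_eq_tsum ℝ]
  have h2 : Real.exp ‖x‖ = ∑' n : ℕ, ((n.factorial : ℝ)⁻¹) • ‖x‖ ^ n := by
    rw [Real.exp_eq_exp_ℝ, NormedSpace.exp_eq_tsum ℝ]
  rw [h1, h2]
  have hs : Summable fun n : ℕ => ((n.factorial : ℝ)⁻¹) • ‖x‖ ^ n :=
    NormedSpace.expSeries_summable' (𝕂 := ℝ) ‖x‖
  refine tsum_of_norm_bounded hs.hasSum (fun n => ?_)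
  rw [norm_smul, smul_eq_mul]
  have : ‖((n.factorial : ℝ)⁻¹)‖ = ((n.factorial : ℝ)⁻¹) := by
    rw [Real.norm_of_nonneg]; positivity
  rw [this]
  gcongr
  exact norm_pow_le x n

lemma norm_pow_sub_pow_bound (X Y : 𝔸) (K : ℝ) (hK : 1 ≤ K) (hX : ‖X‖ ≤ K) (hY : ‖Y‖ ≤ K) (m : ℕ) :
    ‖X ^ m - Y ^ m‖ ≤ m * K ^ m * ‖X - Y‖ := by
  induction m with
  | zero => simp
  | succ m ih =>
    have e : X ^ (m+1) - Y ^ (m+1) = X * (X ^ m - Y ^ m) + (X - Y) * Y ^ m := by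
      rw [pow_succ', pow_succ']; noncomm_ring
    rw [e]
    have hYm : ‖Y ^ m‖ ≤ K ^ m := (norm_pow_le Y m).trans (by gcongr)
    have hKm : 0 ≤ K ^ m := by positivity
    have hXY := norm_nonneg (X - Y)
    calc ‖X * (X ^ m - Y ^ m) + (X - Y) * Y ^ m‖
        ≤ ‖X‖ * ‖X ^ m - Y ^ m‖ + ‖X - Y‖ * ‖Y ^ m‖ :=
          (norm_add_le _ _).trans (add_le_add (norm_mul_le _ _) (norm_mul_le _ _))
      _ ≤ K * (m * K ^ m * ‖X - Y‖) + ‖X - Y‖ * K ^ m := by gcongr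
      _ ≤ K * (m * K ^ m * ‖X - Y‖) + ‖X - Y‖ * (K ^ m * K) := by
          gcongr; nlinarith
      _ = _ := by push_cast; ring

lemma lie_trotter (A B : 𝔸) :
    Tendsto (fun m : ℕ => (NormedSpace.exp ((m:ℝ)⁻¹ • A) * NormedSpace.exp ((m:ℝ)⁻¹ • B)) ^ m)
      atTop (𝓝 (NormedSpace.exp (A + B))) := by
  set f : ℝ → 𝔸 := fun s => NormedSpace.exp (s • A) * NormedSpace.exp (s • B)
    - NormedSpace.exp (s • (A + B)) with hf
  have hd : HasDerivAt f 0 0 := by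
    have h1 := ((hasDerivAt_exp_smul_const A (0:ℝ)).mul (hasDerivAt_exp_smul_const B (0:ℝ))).sub
      (hasDerivAt_exp_smul_const (A+B) (0:ℝ))
    have h2 : NormedSpace.exp ((0:ℝ) • A) * A * NormedSpace.exp ((0:ℝ) • B)
        + NormedSpace.exp ((0:ℝ) • A) * (NormedSpace.exp ((0:ℝ) • B) * B)
        - NormedSpace.exp ((0:ℝ) • (A+B)) * (A+B) = 0 := by
      simp only [zero_smul, NormedSpace.exp_zero, one_mul, mul_one, sub_self]
    rw [h2] at h1
    exact h1
  have hf0 : f 0 = 0 := by simp [hf, NormedSpace.exp_zero]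
  have hlim : Tendsto (fun m : ℕ => (m:ℝ) * ‖f ((m:ℝ)⁻¹)‖) atTop (𝓝 0) := by
    have h2 := hd.tendsto_slope_zero
    simp only [zero_add, hf0, sub_zero] at h2
    have h3 : Tendsto (fun m : ℕ => ((m:ℝ)⁻¹)) atTop (𝓝[≠] (0:ℝ)) := by
      rw [tendsto_nhdsWithin_iff]
      refine ⟨tendsto_inv_atTop_nhds_zero_nat, ?_⟩
      filter_upwards [eventually_gt_atTop 0] with m hm
      have : (m:ℝ) ≠ 0 := by exact_mod_cast hm.ne'
      simpa using this
    have h4 := (h2.comp h3).norm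
    simp only [norm_zero] at h4
    refine h4.congr (fun m => ?_)
    simp [norm_smul]
  rw [tendsto_iff_norm_sub_tendsto_zero]
  set C := Real.exp (‖A‖ + ‖B‖)
  have hb : ∀ᶠ m : ℕ in atTop, ‖(NormedSpace.exp ((m:ℝ)⁻¹ • A) * NormedSpace.exp ((m:ℝ)⁻¹ • B)) ^ m
      - NormedSpace.exp (A + B)‖ ≤ C * ((m:ℝ) * ‖f ((m:ℝ)⁻¹)‖) := by
    filter_upwards [eventually_gt_atTop 0] with m hm
    have hm' : (m:ℝ) ≠ 0 := by exact_mod_cast hm.ne'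
    have hY : NormedSpace.exp (A + B) = (NormedSpace.exp ((m:ℝ)⁻¹ • (A+B))) ^ m := by
      let _ := NormedAlgebra.restrictScalars ℚ ℝ 𝔸
      rw [← NormedSpace.exp_nsmul]
      congr 1
      rw [← Nat.cast_smul_eq_nsmul ℝ, smul_smul, mul_inv_cancel₀ hm', one_smul]
    rw [hY]
    set K := Real.exp ((m:ℝ)⁻¹ * (‖A‖ + ‖B‖))
    have hmi : 0 ≤ (m:ℝ)⁻¹ := by positivity
    have hK : 1 ≤ K := Real.one_le_exp (by positivity)
    have hKm : K ^ m = C := by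
      simp only [K, C]
      rw [← Real.exp_nat_mul]
      congr 1; field_simp
    have hn : ∀ Z : 𝔸, ‖(m:ℝ)⁻¹ • Z‖ = (m:ℝ)⁻¹ * ‖Z‖ := fun Z => by
      rw [norm_smul, Real.norm_of_nonneg hmi]
    have hX : ‖NormedSpace.exp ((m:ℝ)⁻¹ • A) * NormedSpace.exp ((m:ℝ)⁻¹ • B)‖ ≤ K := by
      refine (norm_mul_le _ _).trans ?_
      simp only [K]
      rw [mul_add, Real.exp_add]
      gcongr
      · exact (norm_exp_le_exp_norm _).trans (by rw [hn])
      · exact (norm_exp_le_exp_norm _).trans (by rw [hn])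
    have hYb : ‖NormedSpace.exp ((m:ℝ)⁻¹ • (A+B))‖ ≤ K := by
      refine (norm_exp_le_exp_norm _).trans ?_
      rw [hn]
      simp only [K]
      gcongr
      exact norm_add_le _ _
    refine (norm_pow_sub_pow_bound _ _ K hK hX hYb m).trans ?_
    rw [hKm]
    apply le_of_eq; simp only [hf]; ring
  have hz : Tendsto (fun m : ℕ => C * ((m:ℝ) * ‖f ((m:ℝ)⁻¹)‖)) atTop (𝓝 0) := by
    simpa using hlim.const_mul C
  exact tendsto_of_tendsto_of_tendsto_of_le_of_le' tendsto_const_nhds hz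
    (Eventually.of_forall fun _ => norm_nonneg _) hb
end trotter

section gt
variable {ι : Type*} [Fintype ι] [DecidableEq ι]

lemma trace_pow_comm (A B : Matrix ι ι ℝ) (m : ℕ) : ((A * B) ^ m).trace = ((B * A) ^ m).trace := by
  cases m with
  | zero => simp
  | succ m =>
    have h : ∀ m : ℕ, (A * B) ^ m * A = A * (B * A) ^ m := by
      intro m
      induction m with
      | zero => simp
      | succ m ih => rw [pow_succ', pow_succ', Matrix.mul_assoc, ih]; simp only [Matrix.mul_assoc]
    rw [pow_succ, ← Matrix.mul_assoc, h m, Matrix.mul_assoc, Matrix.trace_mul_comm, pow_succ,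
      Matrix.mul_assoc]

lemma trace_mul_self_transpose_nonneg (A : Matrix ι ι ℝ) : 0 ≤ (A * Aᵀ).trace := by
  simp only [Matrix.trace, Matrix.diag, Matrix.mul_apply, Matrix.transpose_apply]
  exact Finset.sum_nonneg fun i _ => Finset.sum_nonneg fun j _ => mul_self_nonneg _

lemma trace_sq_le (W : Matrix ι ι ℝ) : (W * W).trace ≤ (W * Wᵀ).trace := by
  have h := trace_mul_self_transpose_nonneg (W - Wᵀ)
  rw [transpose_sub, transpose_transpose, Matrix.sub_mul, Matrix.mul_sub, Matrix.mul_sub] at h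
  simp only [trace_sub] at h
  have h1 : (Wᵀ * W).trace = (W * Wᵀ).trace := Matrix.trace_mul_comm _ _
  have h2 : (Wᵀ * Wᵀ).trace = (W * W).trace := by
    rw [← Matrix.transpose_mul, Matrix.trace_transpose]
  linarith

lemma trace_mul_le_half (U V : Matrix ι ι ℝ) (hU : Uᵀ = U) (hV : Vᵀ = V) :
    (U * V).trace ≤ ((U * U).trace + (V * V).trace) / 2 := by
  have h := trace_mul_self_transpose_nonneg (U - V)
  rw [transpose_sub, hU, hV, Matrix.sub_mul, Matrix.mul_sub, Matrix.mul_sub] at h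
  simp only [trace_sub] at h
  have h1 : (V * U).trace = (U * V).trace := Matrix.trace_mul_comm _ _
  linarith

lemma weyl_gt (k : ℕ) :
    (∀ W : Matrix ι ι ℝ, (W ^ 2 ^ (k+1)).trace ≤ ((W * Wᵀ) ^ 2 ^ k).trace) ∧
    (∀ U V : Matrix ι ι ℝ, Uᵀ = U → Vᵀ = V →
      ((U * V) ^ 2 ^ k).trace ≤ (U ^ 2 ^ k * V ^ 2 ^ k).trace) := by
  induction k with
  | zero =>
    refine ⟨fun W => ?_, fun U V _ _ => by simp⟩
    simpa [pow_two] using trace_sq_le W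
  | succ k ih =>
    obtain ⟨ihW, ihG⟩ := ih
    constructor
    · intro W
      have e1 : W ^ 2 ^ (k+1+1) = (W * W) ^ 2 ^ (k+1) := by
        rw [← pow_two, ← pow_mul]; congr 1; ring
      have e2 : (((W * W) * (W * W)ᵀ) ^ 2 ^ k).trace = (((Wᵀ * W) * (W * Wᵀ)) ^ 2 ^ k).trace := by
        rw [Matrix.transpose_mul]
        have := trace_pow_comm (W * W * Wᵀ) Wᵀ (2 ^ k)
        rw [show W * W * (Wᵀ * Wᵀ) = W * W * Wᵀ * Wᵀ by simp only [Matrix.mul_assoc], this]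
        congr 2; simp only [Matrix.mul_assoc]
      rw [e1]
      refine (ihW (W * W)).trans ?_
      rw [e2]
      have hs1 : (Wᵀ * W)ᵀ = Wᵀ * W := by simp [Matrix.transpose_mul]
      have hs2 : (W * Wᵀ)ᵀ = W * Wᵀ := by simp [Matrix.transpose_mul]
      refine (ihG _ _ hs1 hs2).trans ?_
      refine (trace_mul_le_half _ _ (by rw [transpose_pow, hs1]) (by rw [transpose_pow, hs2])).trans ?_
      rw [← pow_add, ← pow_add, trace_pow_comm Wᵀ W, show 2 ^ k + 2 ^ k = 2 ^ (k+1) by ring]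
      linarith
    · intro U V hU hV
      refine (ihW (U * V) |>.trans ?_)
      rw [Matrix.transpose_mul, hU, hV]
      have : (((U * V) * (V * U)) ^ 2 ^ k).trace = (((U * U) * (V * V)) ^ 2 ^ k).trace := by
        rw [show U * V * (V * U) = (U * V * V) * U by simp only [Matrix.mul_assoc],
          trace_pow_comm]
        congr 2; simp only [Matrix.mul_assoc]
      rw [this]
      refine (ihG (U * U) (V * V) (by simp [hU]) (by simp [hV])).trans ?_
      rw [← pow_two, ← pow_two, ← pow_mul, ← pow_mul, show 2 * 2 ^ k = 2 ^ (k+1) by ring]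

open scoped Matrix.Norms.Operator in
lemma lie_trotter_matrix_aux [Nonempty ι] (A B : Matrix ι ι ℝ) :
    Tendsto (fun m : ℕ => (NormedSpace.exp ((m:ℝ)⁻¹ • A) * NormedSpace.exp ((m:ℝ)⁻¹ • B)) ^ m)
      atTop (𝓝 (NormedSpace.exp (A + B))) := lie_trotter A B

lemma lie_trotter_matrix [Nonempty ι] (A B : Matrix ι ι ℝ) :
    Tendsto (fun m : ℕ => (NormedSpace.exp ((m:ℝ)⁻¹ • A) * NormedSpace.exp ((m:ℝ)⁻¹ • B)) ^ m)
      atTop (𝓝 (NormedSpace.exp (A + B))) := lie_trotter_matrix_aux A B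

lemma golden_thompson (A B : Matrix ι ι ℝ) (hA : Aᵀ = A) (hB : Bᵀ = B) :
    (NormedSpace.exp (A + B)).trace ≤ (NormedSpace.exp A * NormedSpace.exp B).trace := by
  rcases isEmpty_or_nonempty ι with h | h
  · simp [Matrix.trace]
  have hl := lie_trotter_matrix A B
  have h2 : Tendsto (fun k : ℕ => 2 ^ k) atTop (atTop : Filter ℕ) :=
    tendsto_pow_atTop_atTop_of_one_lt (by norm_num)
  have hc : Continuous (fun M : Matrix ι ι ℝ => M.trace) := continuous_id.matrix_trace
  have h3 := (hc.tendsto _).comp (hl.comp h2)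
  refine le_of_tendsto h3 (Eventually.of_forall fun k => ?_)
  simp only [Function.comp]
  have hroot : ∀ C : Matrix ι ι ℝ, (NormedSpace.exp (((2 ^ k : ℕ) : ℝ)⁻¹ • C)) ^ 2 ^ k
      = NormedSpace.exp C := by
    intro C
    rw [← Matrix.exp_nsmul]
    congr 1
    rw [← Nat.cast_smul_eq_nsmul ℝ, smul_smul, mul_inv_cancel₀ (by positivity), one_smul]
  refine ((weyl_gt k).2 _ _ ?_ ?_).trans ?_
  · rw [← Matrix.exp_transpose, transpose_smul, hA]
  · rw [← Matrix.exp_transpose, transpose_smul, hB]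
  · rw [hroot, hroot]
end gt
end MJaux

namespace MJaux
open MJ
set_option linter.unusedSectionVars false

section mat
variable {ι : Type*} [Fintype ι] [DecidableEq ι]

lemma diag_exists (S : Matrix ι ι ℝ) (hS : Sᵀ = S) : ∃ (U : Matrix ι ι ℝ) (d : ι → ℝ),
    U * Uᵀ = 1 ∧ Uᵀ * U = 1 ∧ S = U * diagonal d * Uᵀ ∧
      NormedSpace.exp S = U * diagonal (fun i => Real.exp (d i)) * Uᵀ := by
  have hH : S.IsHermitian := by
    rw [Matrix.IsHermitian, Matrix.conjTranspose_eq_transpose_of_trivial]; exact hS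
  have hsp := hH.spectral_theorem
  rw [Unitary.conjStarAlgAut_apply] at hsp
  set U : Matrix ι ι ℝ := (hH.eigenvectorUnitary : Matrix ι ι ℝ) with hU
  have hst : star U = Uᵀ := by
    rw [Matrix.star_eq_conjTranspose, Matrix.conjTranspose_eq_transpose_of_trivial]
  have h1 : U * Uᵀ = 1 := by rw [← hst]; exact Unitary.coe_mul_star_self _
  have h2 : Uᵀ * U = 1 := by rw [← hst]; exact Unitary.coe_star_mul_self _
  rw [hst] at hsp
  have hd : diagonal (RCLike.ofReal ∘ hH.eigenvalues) = (diagonal hH.eigenvalues : Matrix ι ι ℝ) := by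
    congr 1
  rw [hd] at hsp
  clear_value U
  generalize hH.eigenvalues = d at hsp
  refine ⟨U, d, h1, h2, hsp, ?_⟩
  have hinv : U⁻¹ = Uᵀ := Matrix.inv_eq_right_inv h1
  have hunit : IsUnit U := IsUnit.of_mul_eq_one _ h1
  rw [hsp, ← hinv, Matrix.exp_conj U _ hunit, Matrix.exp_diagonal]
  congr 2
  ext i j
  by_cases hij : i = j
  · subst hij
    simp only [diagonal_apply_eq]
    rw [Pi.coe_exp, Real.exp_eq_exp_ℝ]
  · simp [hij]

lemma posSemidef_conj_diag (U : Matrix ι ι ℝ) (d : ι → ℝ) (hd : ∀ i, 0 ≤ d i) :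
    (U * diagonal d * Uᵀ).PosSemidef := by
  have := (Matrix.posSemidef_diagonal_iff.mpr hd).mul_mul_conjTranspose_same U
  rwa [Matrix.conjTranspose_eq_transpose_of_trivial] at this

lemma conj_smul_one (U : Matrix ι ι ℝ) (h : U * Uᵀ = 1) (c : ℝ) :
    c • (1 : Matrix ι ι ℝ) = U * diagonal (fun _ => c) * Uᵀ := by
  rw [← Matrix.smul_one_eq_diagonal, Matrix.mul_smul, Matrix.mul_one, Matrix.smul_mul, h]

lemma exp_le_quad (H : Matrix ι ι ℝ) (hH : Hᵀ = H) (h1 : (1 - H).PosSemidef) :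
    (1 + H + H * H - NormedSpace.exp H).PosSemidef := by
  obtain ⟨U, d, hU, hU', hS, hE⟩ := diag_exists H hH
  have hdle : ∀ i, d i ≤ 1 := by
    intro i
    have hp := h1.mul_mul_conjTranspose_same Uᵀ
    rw [Matrix.conjTranspose_eq_transpose_of_trivial, transpose_transpose] at hp
    have he : Uᵀ * (1 - H) * U = diagonal (fun i => 1 - d i) := by
      rw [Matrix.mul_sub, Matrix.sub_mul, Matrix.mul_one, hU', hS]
      rw [show Uᵀ * (U * diagonal d * Uᵀ) * U = (Uᵀ * U) * diagonal d * (Uᵀ * U) by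
        simp only [Matrix.mul_assoc], hU', Matrix.one_mul, Matrix.mul_one]
      rw [← diagonal_one, diagonal_sub]
    rw [he] at hp
    have := (Matrix.posSemidef_diagonal_iff.mp hp) i
    linarith
  have hHH : H * H = U * diagonal (fun i => d i * d i) * Uᵀ := by
    rw [hS, show U * diagonal d * Uᵀ * (U * diagonal d * Uᵀ)
      = U * diagonal d * (Uᵀ * U) * diagonal d * Uᵀ by simp only [Matrix.mul_assoc], hU',
      Matrix.mul_one, Matrix.mul_assoc U, diagonal_mul_diagonal]
  have hone := conj_smul_one U hU 1
  rw [one_smul] at hone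
  have he : 1 + H + H * H - NormedSpace.exp H
      = U * diagonal (fun i => 1 + d i + d i * d i - Real.exp (d i)) * Uᵀ := by
    rw [hHH, hE, hone]
    nth_rewrite 1 [hS]
    rw [← Matrix.add_mul, ← Matrix.add_mul, ← Matrix.sub_mul, ← Matrix.mul_add, ← Matrix.mul_add,
      ← Matrix.mul_sub, diagonal_add, diagonal_add, diagonal_sub]
  rw [he]
  refine posSemidef_conj_diag _ _ (fun i => ?_)
  have := hdle i
  by_cases hm : -1 ≤ d i
  · have hab : |d i| ≤ 1 := abs_le.mpr ⟨hm, this⟩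
    have := Real.abs_exp_sub_one_sub_id_le hab
    have := (abs_le.mp this).2
    nlinarith
  · push Not at hm
    have h3 : Real.exp (d i) ≤ 1 := Real.exp_le_one_iff.mpr (by linarith)
    nlinarith

lemma trace_exp_mul_le (S X : Matrix ι ι ℝ) (hS : Sᵀ = S) (ρ : ℝ)
    (hX : (ρ • (1 : Matrix ι ι ℝ) - X).PosSemidef) :
    (NormedSpace.exp S * X).trace ≤ ρ * (NormedSpace.exp S).trace := by
  obtain ⟨U, d, hU, hU', hS, hE⟩ := diag_exists S hS
  set E := U * diagonal (fun i => Real.exp (d i / 2)) * Uᵀ with hEdef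
  have hEE : NormedSpace.exp S = E * E := by
    rw [hE, hEdef, show U * diagonal (fun i => Real.exp (d i / 2)) * Uᵀ *
      (U * diagonal (fun i => Real.exp (d i / 2)) * Uᵀ)
      = U * diagonal (fun i => Real.exp (d i / 2)) * (Uᵀ * U) *
        diagonal (fun i => Real.exp (d i / 2)) * Uᵀ by simp only [Matrix.mul_assoc], hU',
      Matrix.mul_one, Matrix.mul_assoc U (diagonal _) (diagonal _), diagonal_mul_diagonal]
    congr 3
    ext i
    rw [← Real.exp_add]; congr 1; ring
  have hET : Eᵀ = E := by
    rw [hEdef]; simp [Matrix.transpose_mul, Matrix.mul_assoc]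
  have hp := hX.mul_mul_conjTranspose_same E
  rw [Matrix.conjTranspose_eq_transpose_of_trivial, hET] at hp
  have ht := hp.trace_nonneg
  rw [Matrix.mul_sub, Matrix.sub_mul, trace_sub, Matrix.mul_smul, Matrix.smul_mul, trace_smul,
    Matrix.mul_one, Matrix.mul_assoc E X E, ← hEE, Matrix.trace_mul_comm, Matrix.mul_assoc,
    ← hEE, Matrix.trace_mul_comm X] at ht
  simp only [smul_eq_mul] at ht
  linarith

lemma posSemidef_of_trace_exp_lt (S : Matrix ι ι ℝ) (hS : Sᵀ = S) (a : ℝ)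
    (h : (NormedSpace.exp S).trace < Real.exp a) :
    (a • (1 : Matrix ι ι ℝ) - S).PosSemidef := by
  obtain ⟨U, d, hU, hU', hS, hE⟩ := diag_exists S hS
  have htr : (NormedSpace.exp S).trace = ∑ i, Real.exp (d i) := by
    rw [hE, Matrix.trace_mul_comm, ← Matrix.mul_assoc, hU', Matrix.one_mul, trace_diagonal]
  have hd : ∀ i, d i ≤ a := by
    intro i
    have : Real.exp (d i) ≤ ∑ i, Real.exp (d i) :=
      Finset.single_le_sum (f := fun i => Real.exp (d i)) (fun j _ => (Real.exp_pos _).le)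
        (Finset.mem_univ i)
    rw [htr] at h
    exact (Real.exp_le_exp.mp (this.trans h.le))
  rw [conj_smul_one U hU a, hS, ← Matrix.sub_mul, ← Matrix.mul_sub, diagonal_sub]
  exact posSemidef_conj_diag _ _ (fun i => by linarith [hd i])

lemma trace_exp_nonneg (S : Matrix ι ι ℝ) (hS : Sᵀ = S) : 0 ≤ (NormedSpace.exp S).trace := by
  obtain ⟨U, d, hU, hU', hS, hE⟩ := diag_exists S hS
  rw [hE, Matrix.trace_mul_comm, ← Matrix.mul_assoc, hU', Matrix.one_mul, trace_diagonal]
  exact Finset.sum_nonneg fun i _ => (Real.exp_pos _).le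

end mat

section path
variable {n : ℕ} (P : Matrix (Fin n) (Fin n) ℝ) (pi0 : Fin n → ℝ)

/-- Expectation over paths. -/
def Ex (N : ℕ) (f : (Fin (N+1) → Fin n) → ℝ) : ℝ := ∑ x, pathWeight N P pi0 x * f x

lemma Ex_succ (N : ℕ) (f : (Fin (N+1+1) → Fin n) → ℝ) :
    Ex P pi0 (N+1) f = Ex P pi0 N (fun x => ∑ j, P (x (Fin.last N)) j *
      f (Fin.snoc (α := fun _ => Fin n) x j)) := by
  unfold Ex
  rw [← (Fin.snocEquiv (fun _ : Fin (N+1+1) => Fin n)).sum_comp, Fintype.sum_prod_type,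
    Finset.sum_comm]
  refine Finset.sum_congr rfl (fun x _ => ?_)
  rw [Finset.mul_sum]
  refine Finset.sum_congr rfl (fun j _ => ?_)
  have hw : pathWeight (N+1) P pi0 (Fin.snoc (α := fun _ => Fin n) x j)
      = pathWeight N P pi0 x * P (x (Fin.last N)) j := by
    unfold pathWeight
    rw [Fin.prod_univ_castSucc]
    have h0 : (Fin.snoc (α := fun _ => Fin n) x j : Fin (N+1+1) → Fin n) 0 = x 0 := by
      rw [← Fin.castSucc_zero, Fin.snoc_castSucc]
    rw [h0]
    simp only [Fin.succ_castSucc, Fin.snoc_castSucc, Fin.succ_last, Fin.snoc_last]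
    ring
  have : (Fin.snocEquiv (fun _ : Fin (N+1+1) => Fin n)) (j, x) = Fin.snoc (α := fun _ => Fin n) x j := rfl
  rw [this, hw]; ring

variable {P pi0}

lemma pathWeight_nonneg (hP : RowStochastic P) (hpi0 : IsProbVec pi0) (N : ℕ)
    (x : Fin (N+1) → Fin n) : 0 ≤ pathWeight N P pi0 x :=
  mul_nonneg (hpi0.1 _) (Finset.prod_nonneg fun _ _ => hP.1 _ _)

lemma Ex_mono (hP : RowStochastic P) (hpi0 : IsProbVec pi0) (N : ℕ)
    {f g : (Fin (N+1) → Fin n) → ℝ} (h : ∀ x, f x ≤ g x) : Ex P pi0 N f ≤ Ex P pi0 N g :=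
  Finset.sum_le_sum fun x _ => mul_le_mul_of_nonneg_left (h x) (pathWeight_nonneg hP hpi0 N x)

lemma Ex_const (hP : RowStochastic P) (hpi0 : IsProbVec pi0) (N : ℕ) (c : ℝ) :
    Ex P pi0 N (fun _ => c) = c := by
  induction N with
  | zero =>
    unfold Ex pathWeight
    simp only [Finset.univ_eq_empty, Finset.prod_empty, mul_one]
    rw [← Finset.sum_mul]
    have : ∑ x : Fin (0+1) → Fin n, pi0 (x 0) = ∑ i, pi0 i := by
      exact (Equiv.funUnique (Fin 1) (Fin n)).sum_comp pi0
    rw [this, hpi0.2, one_mul]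
  | succ N ih =>
    rw [Ex_succ]
    have : (fun x : Fin (N+1) → Fin n => ∑ j, P (x (Fin.last N)) j * c) = fun _ => c := by
      funext x
      rw [← Finset.sum_mul, hP.2, one_mul]
    rw [this, ih]

variable {ι : Type*} [Fintype ι] [DecidableEq ι]

/-- Partial sums along the arithmetic progression `r mod a`. -/
def SS {M : Type*} [AddCommMonoid M] (a r : ℕ) (H : Fin n → Fin n → M) (N : ℕ)
    (x : Fin (N+1) → Fin n) : M :=
  ∑ t : Fin N, if t.val % a = r then H (x t.castSucc) (x t.succ) else 0

lemma SS_snoc {M : Type*} [AddCommMonoid M] (a r : ℕ) (H : Fin n → Fin n → M) (N : ℕ)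
    (x : Fin (N+1) → Fin n) (j : Fin n) :
    SS a r H (N+1) (Fin.snoc (α := fun _ => Fin n) x j)
      = SS a r H N x + if N % a = r then H (x (Fin.last N)) j else 0 := by
  unfold SS
  rw [Fin.sum_univ_castSucc]
  simp only [Fin.succ_castSucc, Fin.snoc_castSucc, Fin.succ_last, Fin.snoc_last,
    Fin.val_castSucc, Fin.val_last]

lemma SS_transpose (a r : ℕ) (H : Fin n → Fin n → Matrix ι ι ℝ) (hH : ∀ i j, (H i j)ᵀ = H i j)
    (N : ℕ) (x : Fin (N+1) → Fin n) : (SS a r H N x)ᵀ = SS a r H N x := by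
  unfold SS
  rw [Matrix.transpose_sum]
  refine Finset.sum_congr rfl (fun t _ => ?_)
  split_ifs
  · exact hH _ _
  · simp

/-- The weighted trace-exponential functional. -/
def QQ (P : Matrix (Fin n) (Fin n) ℝ) (pi0 : Fin n → ℝ) (a r : ℕ)
    (H : Fin n → Fin n → Matrix ι ι ℝ) (N : ℕ) (h : Fin n → Matrix ι ι ℝ) : ℝ :=
  Ex P pi0 N (fun x => (NormedSpace.exp (SS a r H N x) * h (x (Fin.last N))).trace)

variable {a r : ℕ} {H : Fin n → Fin n → Matrix ι ι ℝ}

lemma QQ_skip (N : ℕ) (hN : N % a ≠ r) (h : Fin n → Matrix ι ι ℝ) :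
    QQ P pi0 a r H (N+1) h = QQ P pi0 a r H N (fun i => ∑ j, P i j • h j) := by
  unfold QQ
  rw [Ex_succ]
  congr 1
  funext x
  simp only [SS_snoc, hN, if_false, add_zero, Fin.snoc_last]
  rw [Matrix.mul_sum, Matrix.trace_sum]
  refine Finset.sum_congr rfl fun j _ => ?_
  rw [Matrix.mul_smul, Matrix.trace_smul, smul_eq_mul]

lemma QQ_skips (s k : ℕ) (hs : ∀ u, u < k → (s + u) % a ≠ r) (h : Fin n → Matrix ι ι ℝ) :
    QQ P pi0 a r H (s+k) h = QQ P pi0 a r H s (fun i => ∑ j, (P ^ k) i j • h j) := by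
  induction k generalizing h with
  | zero => simp [Matrix.one_apply]
  | succ k ih =>
    rw [← Nat.add_assoc, QQ_skip _ (hs k (Nat.lt_succ_self k)), ih (fun u hu => hs u (by omega))]
    congr 1
    funext i
    simp only [Finset.smul_sum, smul_smul]
    rw [Finset.sum_comm]
    refine Finset.sum_congr rfl fun j _ => ?_
    rw [← Finset.sum_smul, pow_succ, Matrix.mul_apply]

lemma QQ_event (hP : RowStochastic P) (hpi0 : IsProbVec pi0) (hH : ∀ i j, (H i j)ᵀ = H i j)
    (N : ℕ) (hN : N % a = r) :
    QQ P pi0 a r H (N+1) (fun _ => 1) ≤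
      QQ P pi0 a r H N (fun i => ∑ j, P i j • NormedSpace.exp (H i j)) := by
  unfold QQ
  rw [Ex_succ]
  refine Ex_mono hP hpi0 N (fun x => ?_)
  simp only [SS_snoc, hN, if_true, Matrix.mul_one]
  rw [Matrix.mul_sum, Matrix.trace_sum]
  refine Finset.sum_le_sum fun j _ => ?_
  rw [Matrix.mul_smul, Matrix.trace_smul, smul_eq_mul]
  exact mul_le_mul_of_nonneg_left (golden_thompson _ _ (SS_transpose a r H hH N x) (hH _ _)) (hP.1 _ _)

lemma QQ_le (hP : RowStochastic P) (hpi0 : IsProbVec pi0) (hH : ∀ i j, (H i j)ᵀ = H i j)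
    (N : ℕ) (h : Fin n → Matrix ι ι ℝ) (ρ : ℝ)
    (hh : ∀ i, (ρ • (1 : Matrix ι ι ℝ) - h i).PosSemidef) :
    QQ P pi0 a r H N h ≤ ρ * QQ P pi0 a r H N (fun _ => 1) := by
  unfold QQ Ex
  rw [Finset.mul_sum]
  refine Finset.sum_le_sum fun x _ => ?_
  have := trace_exp_mul_le (SS a r H N x) (h (x (Fin.last N))) (SS_transpose a r H hH N x) ρ (hh _)
  have hw := pathWeight_nonneg hP hpi0 N x
  simp only [Matrix.mul_one]
  nlinarith

lemma QQ_one_nonneg (hP : RowStochastic P) (hpi0 : IsProbVec pi0) (hH : ∀ i j, (H i j)ᵀ = H i j)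
    (N : ℕ) : 0 ≤ QQ P pi0 a r H N (fun _ => 1) := by
  unfold QQ Ex
  refine Finset.sum_nonneg fun x _ => mul_nonneg (pathWeight_nonneg hP hpi0 N x) ?_
  simp only [Matrix.mul_one]
  exact trace_exp_nonneg _ (SS_transpose a r H hH N x)

lemma mgf_bound (hP : RowStochastic P) (hpi0 : IsProbVec pi0) (hH : ∀ i j, (H i j)ᵀ = H i j)
    (ha : 0 < a) (hr : r < a) (ρ ρ0 : ℝ) (hρ : 0 ≤ ρ)
    (hb : ∀ i, (ρ • (1 : Matrix ι ι ℝ)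
      - ∑ j, (P ^ (a-1)) i j • ∑ l, P j l • NormedSpace.exp (H j l)).PosSemidef)
    (hb0 : ∀ i, (ρ0 • (1 : Matrix ι ι ℝ)
      - ∑ j, (P ^ r) i j • ∑ l, P j l • NormedSpace.exp (H j l)).PosSemidef)
    (N : ℕ) (hN : r < N) :
    Ex P pi0 N (fun x => (NormedSpace.exp (SS a r H N x)).trace)
      ≤ ρ0 * ρ ^ ((N - 1 - r) / a) * Fintype.card ι := by
  have key : ∀ q : ℕ, QQ P pi0 a r H (r + q * a + 1) (fun _ => 1) ≤ ρ0 * ρ ^ q * Fintype.card ι := by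
    intro q
    induction q with
    | zero =>
      refine (QQ_event hP hpi0 hH _ (by simp [Nat.mod_eq_of_lt hr])).trans ?_
      have h0 := QQ_skips (P := P) (pi0 := pi0) (a := a) (r := r) (H := H) 0 r
        (fun u hu => by rw [Nat.zero_add, Nat.mod_eq_of_lt (by omega)]; omega)
        (fun i => ∑ j, P i j • NormedSpace.exp (H i j))
      simp only [Nat.zero_add] at h0
      simp only [Nat.zero_mul, Nat.add_zero]
      rw [h0]
      refine (QQ_le hP hpi0 hH 0 _ ρ0 hb0).trans ?_
      have h1 : QQ P pi0 a r H 0 (fun _ => (1 : Matrix ι ι ℝ)) = Fintype.card ι := by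
        have : QQ P pi0 a r H 0 (fun _ => (1 : Matrix ι ι ℝ)) = Ex P pi0 0 (fun _ => (Fintype.card ι : ℝ)) := by
          unfold QQ
          congr 1
          funext x
          simp [SS, NormedSpace.exp_zero]
        rw [this, Ex_const hP hpi0]
      rw [h1]; simp
    | succ q ih =>
      have hmod : ∀ u, (r + q * a + 1 + u) % a = (r + 1 + u) % a := by
        intro u
        rw [show r + q * a + 1 + u = (r + 1 + u) + q * a by ring, Nat.add_mul_mod_self_right]
      have hev : (r + (q+1) * a) % a = r := by
        rw [Nat.add_mul_mod_self_right, Nat.mod_eq_of_lt hr]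
      refine (QQ_event hP hpi0 hH _ hev).trans ?_
      have h0 := QQ_skips (P := P) (pi0 := pi0) (a := a) (r := r) (H := H) (r + q * a + 1) (a-1)
        (fun u hu => by
          rw [hmod]
          intro hc
          have h5 : r + 1 + u < 2 * a := by omega
          rcases lt_or_ge (r + 1 + u) a with h6 | h6
          · rw [Nat.mod_eq_of_lt h6] at hc; omega
          · rw [Nat.mod_eq_sub_mod h6, Nat.mod_eq_of_lt (by omega)] at hc; omega)
        (fun i => ∑ j, P i j • NormedSpace.exp (H i j))
      have e : r + (q+1) * a = r + q * a + 1 + (a - 1) := by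
        have : (q+1) * a = q * a + a := by ring
        omega
      rw [e, h0]
      refine (QQ_le hP hpi0 hH _ _ ρ hb).trans ?_
      calc ρ * QQ P pi0 a r H (r + q * a + 1) (fun _ => 1) ≤ ρ * (ρ0 * ρ ^ q * Fintype.card ι) := by
            gcongr
        _ = _ := by ring
  set q := (N - 1 - r) / a with hq
  obtain ⟨e, he, hN'⟩ : ∃ e, e < a ∧ N = r + q * a + 1 + e := by
    refine ⟨(N - 1 - r) % a, Nat.mod_lt _ ha, ?_⟩
    have := Nat.div_add_mod (N - 1 - r) a
    rw [← hq, Nat.mul_comm] at this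
    omega
  have hF : Ex P pi0 N (fun x => (NormedSpace.exp (SS a r H N x)).trace)
      = QQ P pi0 a r H N (fun _ => 1) := by
    unfold QQ; simp only [Matrix.mul_one]
  rw [hF]
  refine le_trans (le_of_eq ?_) (key q)
  clear_value q
  subst hN'
  rw [QQ_skips (r + q * a + 1) e]
  · have hrow : ∀ k : ℕ, ∀ i, ∑ j, (P ^ k) i j = 1 := by
      intro k
      induction k with
      | zero => intro i; simp [Matrix.one_apply]
      | succ k ih =>
        intro i
        simp only [pow_succ, Matrix.mul_apply]
        rw [Finset.sum_comm]
        simp only [← Finset.mul_sum, hP.2, mul_one, ih]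
    congr 1
    funext i
    rw [← Finset.sum_smul, hrow, one_smul]
  · intro u hu
    rw [show r + q * a + 1 + u = (r + 1 + u) + q * a by ring, Nat.add_mul_mod_self_right]
    intro hc
    rcases lt_or_ge (r + 1 + u) a with h6 | h6
    · rw [Nat.mod_eq_of_lt h6] at hc; omega
    · rw [Nat.mod_eq_sub_mod h6, Nat.mod_eq_of_lt (by omega)] at hc; omega

end path
end MJaux

namespace MJaux
open MJ
set_option linter.unusedSectionVars false

section mixing
variable {n : ℕ} {P : Matrix (Fin n) (Fin n) ℝ} {piv : Fin n → ℝ}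

lemma rs_pow (hP : RowStochastic P) (k : ℕ) : RowStochastic (P ^ k) := by
  induction k with
  | zero =>
    refine ⟨fun i j => ?_, fun i => by simp [Matrix.one_apply]⟩
    rw [pow_zero, Matrix.one_apply]; split_ifs <;> norm_num
  | succ k ih =>
    constructor
    · intro i j
      rw [pow_succ, Matrix.mul_apply]
      exact Finset.sum_nonneg fun l _ => mul_nonneg (ih.1 _ _) (hP.1 _ _)
    · intro i
      simp only [pow_succ, Matrix.mul_apply]
      rw [Finset.sum_comm]
      simp only [← Finset.mul_sum, hP.2, mul_one, ih.2]

lemma stat_pow (hpiv : IsStationary P piv) (k : ℕ) (j : Fin n) :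
    ∑ i, piv i * (P ^ k) i j = piv j := by
  induction k generalizing j with
  | zero => simp [Matrix.one_apply]
  | succ k ih =>
    simp only [pow_succ, Matrix.mul_apply, Finset.mul_sum]
    rw [Finset.sum_comm]
    simp only [← mul_assoc, ← Finset.sum_mul, ih]
    exact hpiv.2 j

lemma contraction (Q : Matrix (Fin n) (Fin n) ℝ) (c : Fin n → ℝ) (κ : ℝ)
    (hQ : ∀ l, ∑ j, |Q l j - c j| ≤ κ) (w : Fin n → ℝ) (hw : ∑ l, w l = 0) :
    ∑ j, |∑ l, w l * Q l j| ≤ κ * ∑ l, |w l| := by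
  have h1 : ∀ j, ∑ l, w l * Q l j = ∑ l, w l * (Q l j - c j) := by
    intro j
    simp only [mul_sub, Finset.sum_sub_distrib, ← Finset.sum_mul, hw, zero_mul, sub_zero]
  calc ∑ j, |∑ l, w l * Q l j| ≤ ∑ j, ∑ l, |w l| * |Q l j - c j| := by
        refine Finset.sum_le_sum fun j _ => ?_
        rw [h1]
        refine (Finset.abs_sum_le_sum_abs _ _).trans (le_of_eq ?_)
        simp only [abs_mul]
    _ = ∑ l, |w l| * ∑ j, |Q l j - c j| := by
        rw [Finset.sum_comm]; simp only [Finset.mul_sum]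
    _ ≤ ∑ l, |w l| * κ := Finset.sum_le_sum fun l _ =>
        mul_le_mul_of_nonneg_left (hQ l) (abs_nonneg _)
    _ = _ := by rw [← Finset.sum_mul, mul_comm]

lemma pow_contr (hP : RowStochastic P) (hpiv : IsStationary P piv) (c : Fin n → ℝ) (κ : ℝ) (hκ : 0 ≤ κ)
    (hQ : ∀ l, ∑ j, |P l j - c j| ≤ κ) (m : ℕ) (i : Fin n) :
    ∑ j, |(P ^ m) i j - piv j| ≤ 2 * κ ^ m := by
  induction m with
  | zero =>
    calc ∑ j, |(P ^ 0) i j - piv j| ≤ ∑ j, ((P ^ 0) i j + piv j) := by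
          refine Finset.sum_le_sum fun j _ => ?_
          have h1 := (rs_pow hP 0).1 i j
          have h2 := hpiv.1.1 j
          rw [abs_le]; constructor <;> linarith
      _ = 2 * κ ^ 0 := by
          rw [Finset.sum_add_distrib, (rs_pow hP 0).2, hpiv.1.2]; norm_num
  | succ m ih =>
    have h := contraction P c κ hQ (fun l => (P ^ m) i l - piv l) (by
      rw [Finset.sum_sub_distrib, (rs_pow hP m).2, hpiv.1.2, sub_self])
    have e : ∀ j, ∑ l, ((P ^ m) i l - piv l) * P l j = (P ^ (m+1)) i j - piv j := by
      intro j
      simp only [sub_mul, Finset.sum_sub_distrib]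
      rw [hpiv.2 j, pow_succ, Matrix.mul_apply]
    simp only [e] at h
    refine h.trans ?_
    calc κ * _ ≤ κ * (2 * κ ^ m) := mul_le_mul_of_nonneg_left ih hκ
      _ = _ := by ring

lemma stationary_pow (hpiv : IsStationary P piv) (k : ℕ) : IsStationary (P ^ k) piv :=
  ⟨hpiv.1, stat_pow hpiv k⟩

lemma piv_pos (hPe : Ergodic' P) (hpiv : IsStationary P piv) (j : Fin n) : 0 < piv j := by
  obtain ⟨t, ht⟩ := hPe
  rw [← stat_pow hpiv t j]
  obtain ⟨i, hi⟩ : ∃ i, 0 < piv i := by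
    by_contra hc
    push Not at hc
    have := Finset.sum_nonpos (s := Finset.univ) (f := piv) fun i _ => hc i
    rw [hpiv.1.2] at this
    linarith
  exact Finset.sum_pos' (fun l _ => mul_nonneg (hpiv.1.1 l) (ht l j).le)
    ⟨i, Finset.mem_univ _, mul_pos hi (ht i j)⟩

lemma mixing_nonempty (hn : 0 < n) (hP : RowStochastic P) (hPe : Ergodic' P)
    (hpiv : IsStationary P piv) :
    ∃ t : ℕ, ∀ i, (1/2) * ∑ j, |(P ^ t) i j - piv j| ≤ 1/4 := by
  obtain ⟨t, ht⟩ := hPe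
  haveI : Nonempty (Fin n) := ⟨⟨0, hn⟩⟩
  obtain ⟨p, hp⟩ := Finite.exists_min (fun p : Fin n × Fin n => (P ^ t) p.1 p.2)
  set δ := (P ^ t) p.1 p.2
  have hδ : 0 < δ := ht _ _
  have hrow : ∀ l, ∑ j, |(P ^ t) l j - δ| ≤ 1 - n * δ := by
    intro l
    have : ∀ j, |(P ^ t) l j - δ| = (P ^ t) l j - δ := fun j =>
      abs_of_nonneg (sub_nonneg.mpr (hp (l, j)))
    simp only [this, Finset.sum_sub_distrib, (rs_pow hP t).2]
    simp
  have hκ0 : 0 ≤ 1 - n * δ := le_trans (Finset.sum_nonneg fun _ _ => abs_nonneg _) (hrow ⟨0, hn⟩)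
  have hκ1 : 1 - n * δ < 1 := by
    have : 0 < (n:ℝ) * δ := by positivity
    linarith
  obtain ⟨m, hm⟩ := exists_pow_lt_of_lt_one (show (0:ℝ) < 1/4 by norm_num) hκ1
  refine ⟨t * m, fun i => ?_⟩
  have := pow_contr (rs_pow hP t) (stationary_pow hpiv t) (fun _ => δ) _ hκ0 hrow m i
  rw [← pow_mul] at this
  linarith

lemma mixing_spec (hn : 0 < n) (hP : RowStochastic P) (hPe : Ergodic' P)
    (hpiv : IsStationary P piv) (i : Fin n) :
    ∑ j, |(P ^ (mixingTime P piv (1/4))) i j - piv j| ≤ 1/2 := by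
  have h := Nat.sInf_mem (s := {t : ℕ | ∀ i, (1/2) * ∑ j, |(P ^ t) i j - piv j| ≤ 1/4})
    (mixing_nonempty hn hP hPe hpiv)
  have := h i
  unfold mixingTime
  linarith

lemma mix_k (hn : 0 < n) (hP : RowStochastic P) (hPe : Ergodic' P)
    (hpiv : IsStationary P piv) (k : ℕ) (i j : Fin n) :
    |(P ^ (mixingTime P piv (1/4) * k)) i j - piv j| ≤ 2 * (1/2) ^ k := by
  have := pow_contr (rs_pow hP _) (stationary_pow hpiv _) piv (1/2) (by norm_num)
    (mixing_spec hn hP hPe hpiv) k i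
  rw [← pow_mul] at this
  exact (Finset.single_le_sum (f := fun j => |(P ^ (mixingTime P piv (1/4) * k)) i j - piv j|)
    (fun _ _ => abs_nonneg _) (Finset.mem_univ j)).trans this

lemma mixing_pos (hn : 2 ≤ n) (hP : RowStochastic P) (hPe : Ergodic' P)
    (hpiv : IsStationary P piv) : 1 ≤ mixingTime P piv (1/4) := by
  by_contra hc
  have h0 : mixingTime P piv (1/4) = 0 := by omega
  have hs := mixing_spec (by omega) hP hPe hpiv
  rw [h0] at hs
  have hbig : ∀ i, 1/2 ≤ piv i := by
    intro i
    have := (Finset.single_le_sum (f := fun j => |(P ^ 0) i j - piv j|)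
      (fun _ _ => abs_nonneg _) (Finset.mem_univ i)).trans (hs i)
    simp only [pow_zero, Matrix.one_apply_eq] at this
    have := (abs_le.mp this).2
    linarith
  have h1 := hs ⟨0, by omega⟩
  have h2 : ∑ j, |(P ^ 0) (⟨0, by omega⟩ : Fin n) j - piv j| ≥
      |(P ^ 0) (⟨0, by omega⟩ : Fin n) ⟨0, by omega⟩ - piv ⟨0, by omega⟩|
      + |(P ^ 0) (⟨0, by omega⟩ : Fin n) ⟨1, by omega⟩ - piv ⟨1, by omega⟩| := by
    have hne : (⟨0, by omega⟩ : Fin n) ≠ ⟨1, by omega⟩ := by simp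
    rw [← Finset.sum_pair (f := fun j => |(P ^ 0) (⟨0, by omega⟩ : Fin n) j - piv j|) hne]
    exact Finset.sum_le_sum_of_subset_of_nonneg (Finset.subset_univ _) fun _ _ _ => abs_nonneg _
  have hsum : piv ⟨0, by omega⟩ + piv ⟨1, by omega⟩ ≤ 1 := by
    have hne : (⟨0, by omega⟩ : Fin n) ≠ ⟨1, by omega⟩ := by simp
    rw [← hpiv.1.2, ← Finset.sum_pair (f := piv) hne]
    exact Finset.sum_le_sum_of_subset_of_nonneg (Finset.subset_univ _) fun _ _ _ => hpiv.1.1 _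
  have hb0 := hbig ⟨0, by omega⟩
  have hb1 := hbig ⟨1, by omega⟩
  rw [pow_zero] at h1
  rw [pow_zero, Matrix.one_apply_eq, Matrix.one_apply_ne (by simp)] at h2
  have h3 := le_abs_self (1 - piv ⟨0, by omega⟩)
  have h4 := neg_abs_le (0 - piv (⟨1, by omega⟩ : Fin n))
  linarith

end mixing

section psd
variable {n : ℕ}

/-- Scalar (diagonal) increments. -/
def HS (i _j : Fin n) : Matrix (Fin n) (Fin n) ℝ :=
  diagonal (fun l => if l = i then -(1/2) else 0)

/-- Martingale increments. -/
def KK (P : Matrix (Fin n) (Fin n) ℝ) (i l : Fin n) : Matrix (Fin n) (Fin n) ℝ :=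
  Matrix.of fun a b => if a = i then ((if b = l then 1 else 0) - P i b) else 0

/-- Hermitian dilation of the martingale increments. -/
def HM (P : Matrix (Fin n) (Fin n) ℝ) (θ : ℝ) (i l : Fin n) : Matrix (Fin n ⊕ Fin n) (Fin n ⊕ Fin n) ℝ :=
  θ • fromBlocks 0 (KK P i l) (KK P i l)ᵀ 0

lemma HS_symm (i j : Fin n) : (HS i j)ᵀ = HS i j := by simp [HS]

lemma HM_symm (P : Matrix (Fin n) (Fin n) ℝ) (θ : ℝ) (i j : Fin n) : (HM P θ i j)ᵀ = HM P θ i j := by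
  simp [HM, fromBlocks_transpose]

lemma psd_of {ι : Type*} [Fintype ι] [DecidableEq ι] (A : Matrix ι ι ℝ) (h : Aᵀ = A)
    (h2 : ∀ x : ι → ℝ, 0 ≤ x ⬝ᵥ (A *ᵥ x)) : A.PosSemidef := by
  refine Matrix.PosSemidef.of_dotProduct_mulVec_nonneg ?_ (fun x => ?_)
  · rw [Matrix.IsHermitian, Matrix.conjTranspose_eq_transpose_of_trivial]; exact h
  · simpa using h2 x

lemma psd_scalar (P : Matrix (Fin n) (Fin n) ℝ) (hP : RowStochastic P) (μ : Fin n → ℝ)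
    (hμ : IsProbVec μ) (p ρ : ℝ) (hp : ∀ l, p ≤ μ l) (hρ : 1 - p * (1 - Real.exp (-(1/2))) ≤ ρ) :
    (ρ • (1 : Matrix (Fin n) (Fin n) ℝ)
      - ∑ j, μ j • ∑ l, P j l • NormedSpace.exp (HS j l)).PosSemidef := by
  have he : ∀ j l : Fin n, NormedSpace.exp (HS j l)
      = diagonal (fun a => if a = j then Real.exp (-(1/2)) else 1) := by
    intro j l
    unfold HS
    rw [Matrix.exp_diagonal]
    congr 1
    funext a
    rw [Pi.coe_exp, ← Real.exp_eq_exp_ℝ]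
    split_ifs <;> simp
  have hsum : ∑ j, μ j • ∑ l, P j l • NormedSpace.exp (HS j l)
      = diagonal (fun a => 1 - μ a * (1 - Real.exp (-(1/2)))) := by
    simp only [he, ← Finset.sum_smul, hP.2, one_smul]
    ext a b
    rw [Matrix.sum_apply]
    by_cases hab : a = b
    · subst hab
      simp only [Matrix.smul_apply, diagonal_apply_eq, smul_eq_mul]
      have : ∀ j, μ j * (if a = j then Real.exp (-(1/2)) else 1)
          = μ j - (if a = j then μ j * (1 - Real.exp (-(1/2))) else 0) := by
        intro j; split_ifs <;> ring
      simp only [this, Finset.sum_sub_distrib, hμ.2]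
      simp
    · simp [hab]
  rw [hsum, smul_one_eq_diagonal, diagonal_sub, Matrix.posSemidef_diagonal_iff]
  intro a
  have h1 : Real.exp (-(1/2)) ≤ 1 := Real.exp_le_one_iff.mpr (by norm_num)
  have := hp a
  nlinarith

variable (P : Matrix (Fin n) (Fin n) ℝ)

lemma HM_mulVec (θ : ℝ) (i l : Fin n) (z : Fin n ⊕ Fin n → ℝ) :
    HM P θ i l *ᵥ z = Sum.elim
      (fun a => if a = i then θ * (z (Sum.inr l) - ∑ b, P i b * z (Sum.inr b)) else 0)
      (fun b => θ * (z (Sum.inl i) * ((if b = l then 1 else 0) - P i b))) := by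
  have hz : z = Sum.elim (z ∘ Sum.inl) (z ∘ Sum.inr) := by simp
  unfold HM
  rw [Matrix.smul_mulVec, fromBlocks_mulVec]
  ext s
  rcases s with a | b
  · simp only [Pi.smul_apply, Sum.elim_inl, zero_mulVec, zero_add, smul_eq_mul, mulVec, dotProduct, KK,
      Matrix.of_apply, Pi.add_apply, Function.comp]
    by_cases ha : a = i
    · simp [ha, sub_mul, Finset.sum_sub_distrib]
    · simp [ha]
  · simp only [Pi.smul_apply, Sum.elim_inr, zero_mulVec, add_zero, smul_eq_mul, mulVec, dotProduct, KK,
      Matrix.of_apply, Pi.add_apply, Function.comp, Matrix.transpose_apply]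
    simp only [Matrix.zero_apply, zero_mul, Finset.sum_const_zero, add_zero, ite_mul]
    rw [Finset.sum_ite_eq' Finset.univ i]
    simp [mul_comm]

/-- the squared norm of the increment vector. -/
def vsq (i l : Fin n) : ℝ := ∑ b, ((if b = l then 1 else 0) - P i b) ^ 2

lemma vsq_eq (i l : Fin n) : vsq P i l = 1 - 2 * P i l + ∑ b, P i b ^ 2 := by
  unfold vsq
  have : ∀ b, ((if b = l then (1:ℝ) else 0) - P i b) ^ 2
      = (if b = l then 1 else 0) - 2 * (if b = l then P i b else 0) + P i b ^ 2 := by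
    intro b; split_ifs <;> ring
  simp only [this, Finset.sum_add_distrib, Finset.sum_sub_distrib, ← Finset.mul_sum]
  simp

variable {P}

lemma sumsq_le (hP : RowStochastic P) (i : Fin n) : ∑ b, P i b ^ 2 ≤ 1 := by
  rw [← hP.2 i]
  refine Finset.sum_le_sum fun b _ => ?_
  have h0 := hP.1 i b
  have h1 : P i b ≤ 1 := by
    rw [← hP.2 i]; exact Finset.single_le_sum (f := fun b => P i b) (fun b _ => hP.1 i b) (Finset.mem_univ b)
  nlinarith

lemma vsq_le (hP : RowStochastic P) (i l : Fin n) : vsq P i l ≤ 2 := by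
  rw [vsq_eq]
  linarith [sumsq_le hP i, hP.1 i l]

lemma HM_form_sq (θ : ℝ) (i l : Fin n) (z : Fin n ⊕ Fin n → ℝ) :
    z ⬝ᵥ ((HM P θ i l * HM P θ i l) *ᵥ z)
      = θ^2 * ((z (Sum.inr l) - ∑ b, P i b * z (Sum.inr b))^2 + z (Sum.inl i)^2 * vsq P i l) := by
  rw [← Matrix.mulVec_mulVec, Matrix.dotProduct_mulVec, ← Matrix.mulVec_transpose, HM_symm, HM_mulVec]
  simp only [dotProduct, Fintype.sum_sum_type, Sum.elim_inl, Sum.elim_inr, vsq, mul_add,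
    Finset.mul_sum]
  congr 1
  · simp only [mul_ite, ite_mul, mul_zero, zero_mul, Finset.sum_ite_eq', Finset.mem_univ, if_true]
    ring
  · refine Finset.sum_congr rfl fun b _ => ?_
    ring

lemma HM_le_one (hP : RowStochastic P) (θ : ℝ) (hθ0 : 0 ≤ θ) (hθ : θ ≤ 1/2) (i l : Fin n) :
    (1 - HM P θ i l).PosSemidef := by
  refine psd_of _ (by rw [transpose_sub, transpose_one, HM_symm]) (fun z => ?_)
  rw [Matrix.sub_mulVec, dotProduct_sub, Matrix.one_mulVec, HM_mulVec]
  simp only [dotProduct, Fintype.sum_sum_type, Sum.elim_inl, Sum.elim_inr]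
  set w := z (Sum.inr l) - ∑ b, P i b * z (Sum.inr b) with hw
  have hw2 : w = ∑ b, ((if b = l then 1 else 0) - P i b) * z (Sum.inr b) := by
    simp [sub_mul, Finset.sum_sub_distrib, hw]
  have hcs : w ^ 2 ≤ 2 * ∑ b, z (Sum.inr b) ^ 2 := by
    rw [hw2]
    refine (Finset.sum_mul_sq_le_sq_mul_sq _ _ _).trans ?_
    exact mul_le_mul_of_nonneg_right (vsq_le hP i l) (Finset.sum_nonneg fun _ _ => sq_nonneg _)
  have e1 : ∑ a, z (Sum.inl a) * (if a = i then θ * w else 0) = θ * (z (Sum.inl i) * w) := by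
    simp; ring
  have e2 : ∑ b, z (Sum.inr b) * (θ * (z (Sum.inl i) * ((if b = l then 1 else 0) - P i b)))
      = θ * (z (Sum.inl i) * w) := by
    rw [hw2, Finset.mul_sum, Finset.mul_sum]
    refine Finset.sum_congr rfl fun b _ => ?_
    ring
  rw [e1, e2]
  have hx : z (Sum.inl i) ^ 2 ≤ ∑ a, z (Sum.inl a) * z (Sum.inl a) := by
    rw [pow_two]
    exact Finset.single_le_sum (f := fun a => z (Sum.inl a) * z (Sum.inl a))
      (fun _ _ => mul_self_nonneg _) (Finset.mem_univ i)
  have hy : ∑ b, z (Sum.inr b) ^ 2 = ∑ b, z (Sum.inr b) * z (Sum.inr b) := by simp only [pow_two]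
  rw [hy] at hcs
  have hy0 : 0 ≤ ∑ b, z (Sum.inr b) * z (Sum.inr b) := Finset.sum_nonneg fun _ _ => mul_self_nonneg _
  have h3 : θ^2 * w^2 ≤ (1/4) * (2 * ∑ b, z (Sum.inr b) * z (Sum.inr b)) := by
    have : θ^2 ≤ 1/4 := by nlinarith
    exact mul_le_mul this hcs (sq_nonneg _) (by norm_num)
  nlinarith [sq_nonneg (z (Sum.inl i) - θ * w)]

lemma HM_mean_zero (hP : RowStochastic P) (θ : ℝ) (i : Fin n) : ∑ l, P i l • HM P θ i l = 0 := by
  have hk : ∀ a b, ∑ l, P i l * KK P i l a b = 0 := by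
    intro a b
    simp only [KK, Matrix.of_apply]
    by_cases ha : a = i
    · simp only [ha, if_true, mul_sub, Finset.sum_sub_distrib, ← Finset.sum_mul, hP.2]
      simp
    · simp [ha]
  ext s t
  rw [Matrix.sum_apply]
  rcases s with s | s <;> rcases t with t | t <;>
    simp only [HM, Matrix.smul_apply, smul_eq_mul, fromBlocks_apply₁₁, fromBlocks_apply₁₂,
      fromBlocks_apply₂₁, fromBlocks_apply₂₂, Matrix.zero_apply, mul_zero, Finset.sum_const_zero,
      Matrix.transpose_apply]
  · have := hk s t
    calc _ = θ * ∑ l, P i l * KK P i l s t := by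
          rw [Finset.mul_sum]; refine Finset.sum_congr rfl fun l _ => ?_; ring
      _ = 0 := by rw [this, mul_zero]
  · have := hk t s
    calc _ = θ * ∑ l, P i l * KK P i l t s := by
          rw [Finset.mul_sum]; refine Finset.sum_congr rfl fun l _ => ?_; ring
      _ = 0 := by rw [this, mul_zero]

lemma psd_sum_smul {ι κ : Type*} [Fintype ι] [DecidableEq ι] [Fintype κ] (c : κ → ℝ) (hc : ∀ k, 0 ≤ c k)
    (A : κ → Matrix ι ι ℝ) (hA : ∀ k, (A k).PosSemidef) : (∑ k, c k • A k).PosSemidef :=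
  Matrix.posSemidef_sum _ fun k _ => (hA k).smul (hc k)

lemma psd_matrix (hP : RowStochastic P) (μ : Fin n → ℝ) (hμ : IsProbVec μ) (v θ : ℝ)
    (hθ0 : 0 ≤ θ) (hθ : θ ≤ 1/2) (hv : ∀ l, μ l ≤ v) (hv2 : ∀ j, ∑ i, μ i * P i j ≤ v) :
    ((1 + θ^2 * v) • (1 : Matrix (Fin n ⊕ Fin n) (Fin n ⊕ Fin n) ℝ)
      - ∑ j, μ j • ∑ l, P j l • NormedSpace.exp (HM P θ j l)).PosSemidef := by
  have h1 : (∑ j, μ j • ∑ l, P j l • (1 + HM P θ j l + HM P θ j l * HM P θ j l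
      - NormedSpace.exp (HM P θ j l))).PosSemidef :=
    psd_sum_smul μ hμ.1 _ fun j => psd_sum_smul _ (hP.1 j) _ fun l =>
      exp_le_quad _ (HM_symm P θ j l) (HM_le_one hP θ hθ0 hθ j l)
  have h2 : ((θ^2 * v) • (1 : Matrix (Fin n ⊕ Fin n) (Fin n ⊕ Fin n) ℝ)
      - ∑ j, μ j • ∑ l, P j l • (HM P θ j l * HM P θ j l)).PosSemidef := by
    refine psd_of _ ?_ (fun z => ?_)
    · rw [transpose_sub, transpose_smul, transpose_one, transpose_sum]
      congr 1
      refine Finset.sum_congr rfl fun j _ => ?_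
      rw [transpose_smul, transpose_sum]
      congr 1
      refine Finset.sum_congr rfl fun l _ => ?_
      rw [transpose_smul, transpose_mul, HM_symm]
    · rw [Matrix.sub_mulVec, dotProduct_sub, Matrix.smul_mulVec, Matrix.one_mulVec, dotProduct_smul,
        Matrix.sum_mulVec, dotProduct_sum]
      simp only [Matrix.smul_mulVec, Matrix.sum_mulVec, dotProduct_smul, dotProduct_sum, HM_form_sq,
        smul_eq_mul]
      have hj : ∀ j, ∑ l, P j l * (θ^2 * ((z (Sum.inr l) - ∑ b, P j b * z (Sum.inr b))^2
          + z (Sum.inl j)^2 * vsq P j l))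
          ≤ θ^2 * (∑ l, P j l * z (Sum.inr l)^2 + z (Sum.inl j)^2) := by
        intro j
        set m := ∑ b, P j b * z (Sum.inr b) with hm
        have e1 : ∑ l, P j l * (z (Sum.inr l) - m)^2 = ∑ l, P j l * z (Sum.inr l)^2 - m^2 := by
          have : ∀ l, P j l * (z (Sum.inr l) - m)^2
              = P j l * z (Sum.inr l)^2 - 2 * m * (P j l * z (Sum.inr l)) + P j l * m^2 := by
            intro l; ring
          simp only [this, Finset.sum_add_distrib, Finset.sum_sub_distrib, ← Finset.mul_sum,
            ← Finset.sum_mul, hP.2, ← hm]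
          ring
        have e2 : ∑ l, P j l * vsq P j l = 1 - ∑ b, P j b ^ 2 := by
          have : ∀ l, P j l * vsq P j l = P j l - 2 * P j l ^ 2 + P j l * ∑ b, P j b ^ 2 := by
            intro l; rw [vsq_eq]; ring
          simp only [this, Finset.sum_add_distrib, Finset.sum_sub_distrib, ← Finset.mul_sum,
            ← Finset.sum_mul, hP.2]
          ring
        have e3 : ∑ l, P j l * (θ^2 * ((z (Sum.inr l) - m)^2 + z (Sum.inl j)^2 * vsq P j l))
            = θ^2 * (∑ l, P j l * (z (Sum.inr l) - m)^2 + z (Sum.inl j)^2 * ∑ l, P j l * vsq P j l) := by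
          rw [Finset.mul_sum, ← Finset.sum_add_distrib, Finset.mul_sum]
          refine Finset.sum_congr rfl fun l _ => ?_
          ring
        rw [e3, e1, e2]
        have h0 : 0 ≤ ∑ b, P j b ^ 2 := Finset.sum_nonneg fun _ _ => sq_nonneg _
        apply mul_le_mul_of_nonneg_left _ (sq_nonneg θ)
        nlinarith [sq_nonneg m, sq_nonneg (z (Sum.inl j)), mul_nonneg (sq_nonneg (z (Sum.inl j))) h0]
      have hA : ∑ j, μ j * ∑ l, P j l * (θ^2 * ((z (Sum.inr l) - ∑ b, P j b * z (Sum.inr b))^2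
          + z (Sum.inl j)^2 * vsq P j l))
          ≤ θ^2 * (∑ l, (∑ j, μ j * P j l) * z (Sum.inr l)^2 + ∑ j, μ j * z (Sum.inl j)^2) := by
        refine (Finset.sum_le_sum fun j _ => mul_le_mul_of_nonneg_left (hj j) (hμ.1 j)).trans (le_of_eq ?_)
        have e4 : ∑ l, (∑ j, μ j * P j l) * z (Sum.inr l)^2
            = ∑ j, μ j * ∑ l, P j l * z (Sum.inr l)^2 := by
          simp only [Finset.sum_mul, Finset.mul_sum]
          rw [Finset.sum_comm]
          refine Finset.sum_congr rfl fun j _ => Finset.sum_congr rfl fun l _ => ?_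
          ring
        rw [e4, ← Finset.sum_add_distrib, Finset.mul_sum]
        refine Finset.sum_congr rfl fun j _ => ?_
        ring
      have hB : ∑ l, (∑ j, μ j * P j l) * z (Sum.inr l)^2 + ∑ j, μ j * z (Sum.inl j)^2
          ≤ v * (z ⬝ᵥ z) := by
        simp only [dotProduct, Fintype.sum_sum_type, mul_add, Finset.mul_sum]
        rw [add_comm]
        refine add_le_add (Finset.sum_le_sum fun j _ => ?_) (Finset.sum_le_sum fun j _ => ?_)
        · rw [← pow_two]; exact mul_le_mul_of_nonneg_right (hv j) (sq_nonneg _)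
        · rw [← pow_two]; exact mul_le_mul_of_nonneg_right (hv2 j) (sq_nonneg _)
      have hC := mul_le_mul_of_nonneg_left hB (sq_nonneg θ)
      have : θ^2 * v * (z ⬝ᵥ z) = θ^2 * (v * (z ⬝ᵥ z)) := by ring
      rw [this]
      linarith
  have h3 := h1.add h2
  have e : ∑ j, μ j • ∑ l, P j l • (1 + HM P θ j l + HM P θ j l * HM P θ j l
      - NormedSpace.exp (HM P θ j l))
      = 1 + ∑ j, μ j • ∑ l, P j l • (HM P θ j l * HM P θ j l)
        - ∑ j, μ j • ∑ l, P j l • NormedSpace.exp (HM P θ j l) := by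
    simp only [smul_add, smul_sub, Finset.sum_add_distrib, Finset.sum_sub_distrib, HM_mean_zero hP,
      ← Finset.sum_smul, hP.2, smul_zero, Finset.sum_const_zero, add_zero, one_smul, hμ.2]
  rw [e] at h3
  convert h3 using 1
  rw [add_smul, one_smul]
  abel

end psd
end MJaux

namespace MJaux
open MJ
set_option linter.unusedSectionVars false

section det
variable {n N : ℕ}

lemma SS_sum {M : Type*} [AddCommMonoid M] (a : ℕ) (ha : 0 < a) (H : Fin n → Fin n → M)
    (x : Fin (N+1) → Fin n) :
    ∑ r ∈ Finset.range a, SS a r H N x = ∑ t : Fin N, H (x t.castSucc) (x t.succ) := by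
  unfold SS
  rw [Finset.sum_comm]
  refine Finset.sum_congr rfl fun t _ => ?_
  rw [Finset.sum_ite_eq, if_pos (Finset.mem_range.mpr (Nat.mod_lt _ ha))]

lemma psd_total {ι : Type*} [Fintype ι] [DecidableEq ι] (a : ℕ) (ha : 0 < a)
    (H : Fin n → Fin n → Matrix ι ι ℝ) (hH : ∀ i j, (H i j)ᵀ = H i j) (c : ℝ)
    (x : Fin (N+1) → Fin n)
    (h : ∀ r ∈ Finset.range a, (NormedSpace.exp (SS a r H N x)).trace < Real.exp c) :
    (((a : ℝ) * c) • (1 : Matrix ι ι ℝ) - ∑ t : Fin N, H (x t.castSucc) (x t.succ)).PosSemidef := by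
  have h1 := Matrix.posSemidef_sum (Finset.range a)
    (x := fun r => c • (1 : Matrix ι ι ℝ) - SS a r H N x)
    (fun r hr => posSemidef_of_trace_exp_lt _ (SS_transpose a r H hH N x) c (h r hr))
  rw [Finset.sum_sub_distrib, SS_sum a ha, Finset.sum_const, Finset.card_range,
    ← Nat.cast_smul_eq_nsmul ℝ, smul_smul] at h1
  exact h1

lemma countState_eq (x : Fin (N+1) → Fin n) (i : Fin n) :
    (countState x i : ℝ) = ∑ t : Fin N, if x t.castSucc = i then (1:ℝ) else 0 := by
  unfold countState; simp

lemma countTrans_eq (x : Fin (N+1) → Fin n) (i j : Fin n) :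
    (countTrans x i j : ℝ) = ∑ t : Fin N, if x t.castSucc = i ∧ x t.succ = j then (1:ℝ) else 0 := by
  unfold countTrans; simp

lemma det_scalar (a : ℕ) (ha : 0 < a) (b : ℝ) (x : Fin (N+1) → Fin n)
    (h : ∀ r ∈ Finset.range a, (NormedSpace.exp (SS a r HS N x)).trace < Real.exp (-b)) (l : Fin n) :
    2 * (a * b) ≤ countState x l := by
  have h1 := psd_total a ha HS HS_symm (-b) x h
  have h2 := h1.diag_nonneg (i := l)
  rw [Matrix.sub_apply, Matrix.sum_apply] at h2
  simp only [HS, diagonal_apply_eq, Matrix.smul_apply, Matrix.one_apply_eq, smul_eq_mul] at h2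
  have e : ∑ t : Fin N, (if l = x t.castSucc then -(1/2:ℝ) else 0) = -(1/2) * countState x l := by
    rw [countState_eq, Finset.mul_sum]
    refine Finset.sum_congr rfl fun t _ => ?_
    simp only [eq_comm]
    split_ifs <;> simp
  rw [e] at h2
  linarith

/-- the martingale matrix. -/
def MM (P : Matrix (Fin n) (Fin n) ℝ) (x : Fin (N+1) → Fin n) : Matrix (Fin n) (Fin n) ℝ :=
  ∑ t : Fin N, KK P (x t.castSucc) (x t.succ)

lemma MM_apply (P : Matrix (Fin n) (Fin n) ℝ) (x : Fin (N+1) → Fin n) (i l : Fin n) :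
    MM P x i l = countTrans x i l - countState x i * P i l := by
  unfold MM
  rw [Matrix.sum_apply, countTrans_eq, countState_eq, Finset.sum_mul, ← Finset.sum_sub_distrib]
  refine Finset.sum_congr rfl fun t _ => ?_
  simp only [KK, Matrix.of_apply]
  by_cases h1 : x t.castSucc = i
  · subst h1
    by_cases h2 : x t.succ = l
    · subst h2; simp
    · have : ¬ l = x t.succ := fun h => h2 h.symm
      simp [h2, this]
  · have : ¬ i = x t.castSucc := fun h => h1 h.symm
    simp [h1, this]

lemma HM_sum (P : Matrix (Fin n) (Fin n) ℝ) (θ : ℝ) (x : Fin (N+1) → Fin n) :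
    ∑ t : Fin N, HM P θ (x t.castSucc) (x t.succ) = θ • fromBlocks 0 (MM P x) (MM P x)ᵀ 0 := by
  ext s t
  rw [Matrix.sum_apply]
  rcases s with s | s <;> rcases t with t | t <;>
    simp [HM, MM, Matrix.sum_apply, Finset.mul_sum]

lemma det_matrix (P : Matrix (Fin n) (Fin n) ℝ) (θ c : ℝ) (hc : 0 < c) (a : ℕ) (ha : 0 < a)
    (x : Fin (N+1) → Fin n)
    (h : ∀ r ∈ Finset.range a, (NormedSpace.exp (SS a r (HM P θ) N x)).trace < Real.exp c)
    (w : Fin n → ℝ) :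
    θ^2 * ∑ i, (MM P x *ᵥ w) i ^ 2 ≤ (a * c)^2 * ∑ i, w i ^ 2 := by
  have h1 := psd_total a ha (HM P θ) (HM_symm P θ) c x h
  rw [HM_sum] at h1
  have hC : 0 < (a:ℝ) * c := mul_pos (by exact_mod_cast ha) hc
  set C := (a:ℝ) * c
  set u : Fin n → ℝ := (θ / C) • (MM P x *ᵥ w) with hu
  have h2 := h1.dotProduct_mulVec_nonneg (Sum.elim u w)
  rw [star_trivial, Matrix.sub_mulVec, Matrix.smul_mulVec, Matrix.one_mulVec, Matrix.smul_mulVec,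
    fromBlocks_mulVec, dotProduct_sub, dotProduct_smul, dotProduct_smul] at h2
  simp only [Sum.elim_comp_inl, Sum.elim_comp_inr, zero_mulVec, zero_add, add_zero,
    sumElim_dotProduct_sumElim, smul_eq_mul] at h2
  have e : w ⬝ᵥ ((MM P x)ᵀ *ᵥ u) = u ⬝ᵥ (MM P x *ᵥ w) := by
    rw [Matrix.mulVec_transpose, Matrix.dotProduct_mulVec, dotProduct_comm]
  have e2 : u ⬝ᵥ (MM P x *ᵥ w) = θ / C * ∑ i, (MM P x *ᵥ w) i ^ 2 := by
    rw [hu, smul_dotProduct, dotProduct, smul_eq_mul]; simp only [pow_two]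
  have e3 : u ⬝ᵥ u = (θ / C)^2 * ∑ i, (MM P x *ᵥ w) i ^ 2 := by
    rw [hu, smul_dotProduct, dotProduct_smul, dotProduct, smul_eq_mul, smul_eq_mul]
    simp only [pow_two]; ring
  have e4 : w ⬝ᵥ w = ∑ i, w i ^ 2 := by rw [dotProduct]; simp only [pow_two]
  rw [e, e2, e3, e4] at h2
  set S := ∑ i, (MM P x *ᵥ w) i ^ 2
  set T := ∑ i, w i ^ 2
  have h3 : C * (C * ((θ / C) ^ 2 * S + T) - θ * (θ / C * S + θ / C * S))
     = C^2 * T - θ^2 * S := by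
    field_simp; ring
  have h4 := mul_nonneg hC.le h2
  rw [h3] at h4
  linarith

lemma det_spec (P : Matrix (Fin n) (Fin n) ℝ) (x : Fin (N+1) → Fin n) (K B : ℝ) (hK : 0 < K)
    (hB : 0 ≤ B) (hcount : ∀ i, K ≤ countState x i)
    (hM : ∀ w : Fin n → ℝ, ∑ i, (MM P x *ᵥ w) i ^ 2 ≤ B^2 * ∑ i, w i ^ 2) :
    spec (empMatrix x - P) ≤ B / K := by
  refine csSup_le ⟨_, 0, by simp [l2], rfl⟩ ?_
  rintro c ⟨w, hw, rfl⟩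
  unfold l2 at hw ⊢
  have hw1 : ∑ i, w i ^ 2 ≤ 1 := by
    have h0 : 0 ≤ ∑ i, w i ^ 2 := Finset.sum_nonneg fun _ _ => sq_nonneg _
    have := Real.sq_sqrt h0
    nlinarith [Real.sqrt_nonneg (∑ i, w i ^ 2)]
  apply Real.sqrt_le_iff.mpr
  refine ⟨by positivity, ?_⟩
  have e : ∀ i, ((empMatrix x - P) *ᵥ w) i = (MM P x *ᵥ w) i / countState x i := by
    intro i
    have hpos : (0:ℝ) < countState x i := hK.trans_le (hcount i)
    have hne : countState x i ≠ 0 := by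
      intro h0; rw [h0] at hpos; simp at hpos
    simp only [mulVec, dotProduct, Finset.sum_div]
    refine Finset.sum_congr rfl fun l _ => ?_
    rw [MM_apply, Matrix.sub_apply]
    simp only [empMatrix, Matrix.of_apply, hne, if_false]
    field_simp
  simp only [e]
  calc ∑ i, ((MM P x *ᵥ w) i / countState x i) ^ 2 ≤ ∑ i, (MM P x *ᵥ w) i ^ 2 / K^2 := by
        refine Finset.sum_le_sum fun i _ => ?_
        rw [div_pow]
        have := hcount i
        gcongr
    _ = (∑ i, (MM P x *ᵥ w) i ^ 2) / K^2 := by rw [Finset.sum_div]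
    _ ≤ B^2 / K^2 := by
        gcongr
        exact (hM w).trans (by nlinarith [sq_nonneg B])
    _ = (B/K)^2 := by rw [div_pow]

lemma spec_ge_one (hn : 0 < n) (P : Matrix (Fin n) (Fin n) ℝ) (hP : RowStochastic P) :
    1 ≤ spec P := by
  have hn' : (0:ℝ) < n := by exact_mod_cast hn
  apply le_csSup
  · refine ⟨Real.sqrt n, ?_⟩
    rintro c ⟨w, hw, rfl⟩
    unfold l2 at hw ⊢
    apply Real.sqrt_le_sqrt
    have hw1 : ∑ i, w i ^ 2 ≤ 1 := by
      have h0 : 0 ≤ ∑ i, w i ^ 2 := Finset.sum_nonneg fun _ _ => sq_nonneg _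
      have := Real.sq_sqrt h0
      nlinarith [Real.sqrt_nonneg (∑ i, w i ^ 2)]
    calc ∑ i, (P *ᵥ w) i ^ 2 ≤ ∑ i : Fin n, (1:ℝ) := by
          refine Finset.sum_le_sum fun i _ => ?_
          refine (Finset.sum_mul_sq_le_sq_mul_sq Finset.univ (fun b => P i b) w).trans ?_
          have := sumsq_le hP i
          have h0 : 0 ≤ ∑ b, P i b ^ 2 := Finset.sum_nonneg fun _ _ => sq_nonneg _
          have h0 : 0 ≤ ∑ b, w b ^ 2 := Finset.sum_nonneg fun _ _ => sq_nonneg _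
          nlinarith
      _ = n := by simp
  · refine ⟨fun _ => 1 / Real.sqrt n, ?_, ?_⟩
    · unfold l2
      rw [Real.sqrt_le_one]
      simp [Real.sq_sqrt hn'.le, hn'.ne']
    · have : P *ᵥ (fun _ => 1 / Real.sqrt n) = fun _ => 1 / Real.sqrt n := by
        funext i
        simp only [mulVec, dotProduct, ← Finset.sum_mul, hP.2, one_mul]
      rw [this]
      unfold l2
      simp [Real.sq_sqrt hn'.le, hn'.ne']

end det
end MJaux

namespace MJaux
open MJ
set_option linter.unusedSectionVars false

section fin
variable {n N : ℕ} {P : Matrix (Fin n) (Fin n) ℝ} {piv pi0 : Fin n → ℝ}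

lemma union_bound (hP : RowStochastic P) (hpi0 : IsProbVec pi0) (a : ℕ) (ha : 0 < a)
    (θ b c T : ℝ) (hθ : 0 < θ) (hb : 0 < b) (hc : 0 < c)
    (hT : (a * c / θ) / (2 * (a * b)) ≤ T) :
    1 - ∑ r ∈ Finset.range a, Real.exp (-c) *
          Ex P pi0 N (fun x => (NormedSpace.exp (SS a r (HM P θ) N x)).trace)
      - ∑ r ∈ Finset.range a, Real.exp b *
          Ex P pi0 N (fun x => (NormedSpace.exp (SS a r HS N x)).trace)
      ≤ pathProb N P pi0 {x | spec (empMatrix x - P) ≤ T} := by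
  have ha' : (0:ℝ) < a := by exact_mod_cast ha
  set F : (Fin (N+1) → Fin n) → ℝ := fun x =>
    ∑ r ∈ Finset.range a, Real.exp (-c) * (NormedSpace.exp (SS a r (HM P θ) N x)).trace with hF
  set G : (Fin (N+1) → Fin n) → ℝ := fun x =>
    ∑ r ∈ Finset.range a, Real.exp b * (NormedSpace.exp (SS a r HS N x)).trace with hG
  have hFt : ∀ x : Fin (N+1) → Fin n, ∀ r ∈ Finset.range a,
      0 ≤ Real.exp (-c) * (NormedSpace.exp (SS a r (HM P θ) N x)).trace := fun x r _ =>
    mul_nonneg (Real.exp_pos _).le (trace_exp_nonneg _ (SS_transpose a r _ (HM_symm P θ) N x))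
  have hGt : ∀ x : Fin (N+1) → Fin n, ∀ r ∈ Finset.range a,
      0 ≤ Real.exp b * (NormedSpace.exp (SS a r HS N x)).trace := fun x r _ =>
    mul_nonneg (Real.exp_pos _).le (trace_exp_nonneg _ (SS_transpose a r _ HS_symm N x))
  have hF0 : ∀ x, 0 ≤ F x := fun x => Finset.sum_nonneg (hFt x)
  have hG0 : ∀ x, 0 ≤ G x := fun x => Finset.sum_nonneg (hGt x)
  have e1 : ∑ r ∈ Finset.range a, Real.exp (-c) *
          Ex P pi0 N (fun x => (NormedSpace.exp (SS a r (HM P θ) N x)).trace) = Ex P pi0 N F := by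
    unfold Ex
    simp only [hF, Finset.mul_sum]
    rw [Finset.sum_comm]
    refine Finset.sum_congr rfl fun x _ => Finset.sum_congr rfl fun r _ => ?_
    ring
  have e2 : ∑ r ∈ Finset.range a, Real.exp b *
          Ex P pi0 N (fun x => (NormedSpace.exp (SS a r HS N x)).trace) = Ex P pi0 N G := by
    unfold Ex
    simp only [hG, Finset.mul_sum]
    rw [Finset.sum_comm]
    refine Finset.sum_congr rfl fun x _ => Finset.sum_congr rfl fun r _ => ?_
    ring
  rw [e1, e2, ← Ex_const hP hpi0 N 1]
  unfold Ex pathProb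
  rw [← Finset.sum_sub_distrib, ← Finset.sum_sub_distrib]
  refine Finset.sum_le_sum fun x _ => ?_
  have hw := pathWeight_nonneg hP hpi0 N x
  by_cases hx : spec (empMatrix x - P) ≤ T
  · rw [Set.indicator_of_mem (by exact hx)]
    nlinarith [mul_nonneg hw (hF0 x), mul_nonneg hw (hG0 x)]
  · rw [Set.indicator_of_notMem (by exact hx)]
    suffices h : 1 ≤ F x + G x by nlinarith
    by_contra hlt
    push Not at hlt
    apply hx
    have hFl : F x < 1 := by linarith [hG0 x]
    have hGl : G x < 1 := by linarith [hF0 x]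
    have hA : ∀ r ∈ Finset.range a,
        (NormedSpace.exp (SS a r (HM P θ) N x)).trace < Real.exp c := by
      intro r hr
      have := (Finset.single_le_sum (hFt x) hr).trans_lt hFl
      rwa [Real.exp_neg, inv_mul_lt_iff₀ (Real.exp_pos _), mul_one] at this
    have hB : ∀ r ∈ Finset.range a,
        (NormedSpace.exp (SS a r HS N x)).trace < Real.exp (-b) := by
      intro r hr
      have := (Finset.single_le_sum (hGt x) hr).trans_lt hGl
      rw [Real.exp_neg]
      rwa [← lt_inv_mul_iff₀ (Real.exp_pos _), mul_one] at this
    refine (det_spec P x (2 * (a * b)) (a * c / θ) (by positivity) (by positivity)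
      (det_scalar a ha b x hB) (fun w => ?_)).trans hT
    have h1 := det_matrix P θ c hc a ha x hA w
    rw [div_pow, div_mul_eq_mul_div, le_div_iff₀ (by positivity)]
    linarith

lemma exp_half : Real.exp (-(1/2)) ≤ 0.61 := by
  have h1 := Real.exp_one_gt_d9
  have h2 : Real.exp (-(1/2)) ^ 2 = (Real.exp 1)⁻¹ := by
    rw [← Real.exp_nat_mul, ← Real.exp_neg]; norm_num
  have h3 : (Real.exp 1)⁻¹ ≤ 0.61^2 := by
    rw [inv_le_comm₀ (Real.exp_pos _) (by norm_num)]
    norm_num at h1 ⊢; linarith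
  have h4 := Real.exp_pos (-(1/2))
  nlinarith

lemma exp_29 : Real.exp 0.29 ≤ 1.5 := by
  have := Real.abs_exp_sub_one_sub_id_le (x := 0.29) (by norm_num [abs_le])
  have := (abs_le.mp this).2
  norm_num at this ⊢; linarith

lemma num_matrix (e M y X θ : ℝ) (q : ℕ) (hM : 0 < M) (he : 0 < e) 
    (hθ : θ = e / M) (hθ2 : θ ≤ 1/2) (hqy : (q:ℝ) ≤ y) (hX : X ≤ 0.75 * (e^2 * y / M)) (n : ℕ) :
    Real.exp (-(2 * θ * e * y)) * ((1 + θ^2 * 1) * (1 + θ^2 * (5/4 * M))^q * (n + n : ℝ))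
      ≤ 2.5 * n * Real.exp (-X) := by
  have hθ0 : 0 < θ := by rw [hθ]; positivity
  have h1 : (1 + θ^2 * (5/4 * M))^q ≤ Real.exp (θ^2 * (5/4 * M) * y) := by
    calc (1 + θ^2 * (5/4 * M))^q ≤ (Real.exp (θ^2 * (5/4 * M)))^q := by
          gcongr
          linarith [Real.add_one_le_exp (θ^2 * (5/4 * M))]
      _ = Real.exp (q * (θ^2 * (5/4 * M))) := by rw [← Real.exp_nat_mul]
      _ ≤ _ := by
          apply Real.exp_le_exp.mpr
          have : 0 ≤ θ^2 * (5/4 * M) := by positivity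
          nlinarith
  have h2 : 1 + θ^2 * 1 ≤ 5/4 := by nlinarith
  calc _ ≤ Real.exp (-(2 * θ * e * y)) * ((5/4) * Real.exp (θ^2 * (5/4 * M) * y) * (n + n : ℝ)) := by
        gcongr
    _ = 2.5 * n * (Real.exp (-(2 * θ * e * y)) * Real.exp (θ^2 * (5/4 * M) * y)) := by ring
    _ = 2.5 * n * Real.exp (-(0.75 * (e^2 * y / M))) := by
        rw [← Real.exp_add]
        congr 2
        rw [hθ]; field_simp; ring
    _ ≤ _ := by
        gcongr

lemma num_scalar (m y X : ℝ) (q : ℕ) (hm : 0 < m) (hm2 : m ≤ 1/2) (hqy : y - 2 ≤ q)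
    (hX : X ≤ 0.04 * (y * m)) (n : ℕ) :
    Real.exp (y * m / 4) * (1 * Real.exp (-(0.29 * m)) ^ q * (n : ℝ))
      ≤ 1.5 * n * Real.exp (-X) := by
  have h1 : Real.exp (y * m / 4) * Real.exp (-(0.29 * m)) ^ q ≤ 1.5 * Real.exp (-X) := by
    calc _ = Real.exp (y * m / 4 + q * (-(0.29 * m))) := by rw [← Real.exp_nat_mul, Real.exp_add]
      _ ≤ Real.exp (0.29 + -X) := by
        apply Real.exp_le_exp.mpr
        nlinarith
      _ = Real.exp 0.29 * Real.exp (-X) := Real.exp_add _ _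
      _ ≤ _ := by gcongr; exact exp_29
  calc _ = n * (Real.exp (y * m / 4) * Real.exp (-(0.29 * m)) ^ q) := by ring
    _ ≤ n * (1.5 * Real.exp (-X)) := by gcongr
    _ = _ := by ring

lemma row_prob (hP : RowStochastic P) (k : ℕ) (i : Fin n) : IsProbVec (fun j => (P^k) i j) :=
  ⟨(rs_pow hP k).1 i, (rs_pow hP k).2 i⟩

lemma prob_le_one {μ : Fin n → ℝ} (hμ : IsProbVec μ) (l : Fin n) : μ l ≤ 1 := by
  rw [← hμ.2]; exact Finset.single_le_sum (fun i _ => hμ.1 i) (Finset.mem_univ l)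

/-- choice of the block length. -/
lemma block_len (hn : 2 ≤ n) (hP : RowStochastic P) (hPe : Ergodic' P) (hpiv : IsStationary P piv)
    (e : ℝ) (he : 0 < e) (he4 : e ≤ 1/4) :
    ∃ a : ℕ, 0 < a ∧ (a:ℝ) ≤ 6 * mixingTime P piv (1/4) * Real.log e⁻¹ ∧
      ∀ i j, |(P^(a-1)) i j - piv j| ≤ e / 2 := by
  set L := Real.log e⁻¹ with hL
  have hlog := Real.log_two_gt_d9
  have hlog2 := Real.log_two_lt_d9
  have hL2 : 2 * Real.log 2 ≤ L := by
    rw [hL]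
    have : 2 * Real.log 2 = Real.log 4 := by
      rw [show (4:ℝ) = 2^2 by norm_num, Real.log_pow]; norm_num
    rw [this]
    apply Real.log_le_log (by norm_num)
    rw [le_inv_comm₀ (by norm_num) he]; linarith
  have hτ1 : (1:ℝ) ≤ mixingTime P piv (1/4) := by exact_mod_cast mixing_pos hn hP hPe hpiv
  set τ := mixingTime P piv (1/4) with hτ
  set k := ⌈L / Real.log 2⌉₊ + 2 with hk
  refine ⟨τ * k + 1, Nat.succ_pos _, ?_, fun i j => ?_⟩
  · have hk1 : (k:ℝ) ≤ L / Real.log 2 + 3 := by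
      have := (Nat.ceil_lt_add_one (a := L / Real.log 2) (div_nonneg (by linarith) (by linarith))).le
      rw [hk]; push_cast; linarith
    have h2 : L / Real.log 2 ≤ 1.5 * L := by
      rw [div_le_iff₀ (by linarith)]
      nlinarith
    push_cast
    have h3 : (k:ℝ) + 1 ≤ 6 * L := by linarith
    nlinarith
  · rw [Nat.add_sub_cancel]
    refine (mix_k (by omega) hP hPe hpiv k i j).trans ?_
    have hk2 : L + 2 * Real.log 2 ≤ k * Real.log 2 := by
      have := Nat.le_ceil (L / Real.log 2)
      rw [div_le_iff₀ (by linarith)] at this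
      rw [hk]; push_cast; linarith
    have h3 : (1/2:ℝ)^k ≤ e / 4 := by
      have e1 : (1/2:ℝ)^k = Real.exp (-(k * Real.log 2)) := by
        rw [Real.exp_neg, Real.exp_nat_mul, Real.exp_log (by norm_num)]; simp
      have e2 : e / 4 = Real.exp (-(L + 2 * Real.log 2)) := by
        rw [Real.exp_neg, Real.exp_add, hL, Real.exp_log (by positivity), mul_comm 2,
          Real.exp_mul, Real.exp_log (by norm_num)]
        norm_num [div_eq_mul_inv]
        ring
      rw [e1, e2]
      exact Real.exp_le_exp.mpr (by linarith)
    linarith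

lemma main_ge2 (hn : 2 ≤ n) (hP : RowStochastic P) (hPe : Ergodic' P) (hpiv : IsStationary P piv)
    (hpi0 : IsProbVec pi0) (M m : ℝ) (hm : 0 < m) (hmle : ∀ i, m ≤ piv i) (hMge : ∀ i, piv i ≤ M)
    (hm2 : m ≤ 1/2) (τ : ℝ) (hτ : τ = (mixingTime P piv (1/4) : ℝ))
    (e T : ℝ) (he : 0 < e) (hem : e ≤ m / 2) (hT : 4 * m⁻¹ * e ≤ T) :
    1 - 24 * n * τ * Real.log e⁻¹ *
        Real.exp (-(N : ℝ) / (100 * τ * M * Real.log e⁻¹ * e⁻¹ ^ 2))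
      ≤ pathProb N P pi0 {x | spec (empMatrix x - P) ≤ T} := by
  have hτ1 : 1 ≤ τ := by rw [hτ]; exact_mod_cast mixing_pos hn hP hPe hpiv
  have hmM : m ≤ M := (hmle ⟨0, by omega⟩).trans (hMge _)
  have hM : 0 < M := hm.trans_le hmM
  obtain ⟨a, ha, haL, hmix⟩ := block_len hn hP hPe hpiv e he (by linarith)
  rw [← hτ] at haL
  have hL1 : 1 ≤ Real.log e⁻¹ := by
    rw [Real.le_log_iff_exp_le (by positivity)]
    have : (4:ℝ) ≤ e⁻¹ := by rw [le_inv_comm₀ (by norm_num) he]; linarith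
    linarith [Real.exp_one_lt_d9]
  set L := Real.log e⁻¹ with hLdef
  have ha' : (0:ℝ) < a := by exact_mod_cast ha
  have hτL : 1 ≤ τ * L := by nlinarith
  have hn' : (2:ℝ) ≤ n := by exact_mod_cast hn
  set X := (N:ℝ) / (100 * τ * M * L * e⁻¹ ^ 2) with hX
  rw [neg_div, ← hX]
  have hN0 : (0:ℝ) ≤ N := Nat.cast_nonneg N
  have hXe : X = N / (τ * L) * (e^2 / M) / 100 := by
    rw [hX]; field_simp
  rcases lt_or_ge N a with hNa | hNa
  · have h1 : X ≤ 1 := by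
      have h1 : N / (τ * L) ≤ 6 := by
        rw [div_le_iff₀ (by linarith)]
        have : (N:ℝ) < a := by exact_mod_cast hNa
        linarith
      have h2 : e^2 / M ≤ 1 := by
        rw [div_le_iff₀ hM]; nlinarith
      have h3 : N / (τ * L) * (e^2 / M) ≤ 6 * 1 := by
        apply mul_le_mul h1 h2 (by positivity) (by norm_num)
      rw [hXe]; linarith
    have h2 : 1/3 ≤ Real.exp (-X) := by
      have : Real.exp (-1) ≤ Real.exp (-X) := Real.exp_le_exp.mpr (by linarith)
      refine le_trans ?_ this
      rw [Real.exp_neg, one_div]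
      apply inv_anti₀ (Real.exp_pos _)
      linarith [Real.exp_one_lt_d9]
    have h3 : 1 ≤ 24 * n * τ * L * Real.exp (-X) := by
      have : 2 ≤ n * (τ * L) := by nlinarith
      have : (2:ℝ) * (1/3) ≤ n * (τ * L) * Real.exp (-X) :=
        mul_le_mul this h2 (by norm_num) (by linarith)
      nlinarith
    have h4 : 0 ≤ pathProb N P pi0 {x | spec (empMatrix x - P) ≤ T} :=
      Finset.sum_nonneg fun x _ => Set.indicator_nonneg (fun x _ => pathWeight_nonneg hP hpi0 N x) x
    linarith
  · have hNpos : (0:ℝ) < N := by exact_mod_cast (lt_of_lt_of_le ha hNa)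
    set y : ℝ := N / a with hy
    have hy0 : 0 < y := by positivity
    have hyN : N / (τ * L) ≤ 6 * y := by
      rw [hy, div_le_iff₀ (by linarith), ← mul_div_assoc, div_mul_eq_mul_div, le_div_iff₀ ha']
      nlinarith
    set θ := e / M with hθ
    have hθ0 : 0 < θ := by positivity
    have hθ2 : θ ≤ 1/2 := by rw [hθ, div_le_iff₀ hM]; linarith
    have hX1 : X ≤ 0.75 * (e^2 * y / M) := by
      rw [hXe]
      have : N / (τ * L) * (e^2 / M) ≤ 6 * y * (e^2 / M) := by gcongr
      have h0 : 0 ≤ e^2 * y / M := by positivity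
      have e0 : 6 * y * (e^2 / M) = 6 * (e^2 * y / M) := by ring
      norm_num at *
      linarith
    have hX2 : X ≤ 0.04 * (y * m) := by
      rw [hXe]
      have h1 : e^2 / M ≤ m / 4 := by
        rw [div_le_iff₀ hM]; nlinarith
      have : N / (τ * L) * (e^2 / M) ≤ 6 * y * (m / 4) := by
        apply mul_le_mul hyN h1 (by positivity) (by positivity)
      have h0 : 0 ≤ y * m := by positivity
      norm_num
      linarith
    have hub := union_bound (N := N) hP hpi0 a ha θ (y * m / 4) (2 * θ * e * y) T hθ0 (by positivity)
      (by positivity) (le_trans (le_of_eq (by field_simp)) hT)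
    refine le_trans ?_ hub
    have hpe : ∀ i j, (P^(a-1)) i j ≤ 5/4 * piv j ∧ 3/4 * m ≤ (P^(a-1)) i j := by
      intro i j
      have := abs_le.mp (hmix i j)
      have := hmle j
      constructor <;> linarith
    have hA : ∀ r ∈ Finset.range a, Real.exp (-(2 * θ * e * y)) *
        Ex P pi0 N (fun x => (NormedSpace.exp (SS a r (HM P θ) N x)).trace)
        ≤ 2.5 * n * Real.exp (-X) := by
      intro r hr
      have hra := Finset.mem_range.mp hr
      have hq1 : (((N-1-r)/a : ℕ) : ℝ) ≤ y := by
        rw [hy]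
        refine Nat.cast_div_le.trans ?_
        gcongr
        omega
      have hmg := mgf_bound (H := HM P θ) hP hpi0 (HM_symm P θ) ha hra (1 + θ^2 * (5/4 * M)) (1 + θ^2 * 1)
        (by positivity)
        (fun i => psd_matrix hP _ (row_prob hP (a-1) i) _ θ hθ0.le hθ2
          (fun l => (hpe i l).1.trans (by linarith [hMge l]))
          (fun j => by
            have : ∑ l, (P^(a-1)) i l * P l j ≤ ∑ l, (5/4) * (piv l * P l j) := by
              refine Finset.sum_le_sum fun l _ => ?_
              have := mul_le_mul_of_nonneg_right (hpe i l).1 (hP.1 l j)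
              linarith
            rw [← Finset.mul_sum, hpiv.2] at this
            linarith [hMge j]))
        (fun i => psd_matrix hP _ (row_prob hP r i) _ θ hθ0.le hθ2
          (fun l => prob_le_one (row_prob hP r i) l)
          (fun j => by
            have := prob_le_one (row_prob hP (r+1) i) j
            rwa [pow_succ, Matrix.mul_apply] at this))
        N (by omega)
      refine le_trans (mul_le_mul_of_nonneg_left hmg (Real.exp_pos _).le) ?_
      have := num_matrix e M y X θ ((N-1-r)/a) hM he hθ hθ2 hq1 hX1 n
      simpa using this
    have hB : ∀ r ∈ Finset.range a, Real.exp (y * m / 4) *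
        Ex P pi0 N (fun x => (NormedSpace.exp (SS a r HS N x)).trace)
        ≤ 1.5 * n * Real.exp (-X) := by
      intro r hr
      have hra := Finset.mem_range.mp hr
      have hq2 : y - 2 ≤ (((N-1-r)/a : ℕ) : ℝ) := by
        have h1 : N ≤ a * ((N-1-r)/a) + 2 * a := by
          have := Nat.div_add_mod (N-1-r) a
          have := Nat.mod_lt (N-1-r) ha
          omega
        have h2 : (N:ℝ) ≤ a * (((N-1-r)/a : ℕ) : ℝ) + 2 * a := by exact_mod_cast h1
        rw [sub_le_iff_le_add, hy, div_le_iff₀ ha']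
        linarith
      have hmg := mgf_bound (H := HS) hP hpi0 HS_symm ha hra (Real.exp (-(0.29 * m))) 1
        (Real.exp_pos _).le
        (fun i => psd_scalar P hP _ (row_prob hP (a-1) i) (3/4 * m) _
          (fun l => (hpe i l).2)
          (by
            have h1 := exp_half
            have h2 := Real.add_one_le_exp (-(0.29 * m))
            nlinarith))
        (fun i => psd_scalar P hP _ (row_prob hP r i) 0 _ (fun l => (row_prob hP r i).1 l)
          (by simp))
        N (by omega)
      refine le_trans (mul_le_mul_of_nonneg_left hmg (Real.exp_pos _).le) ?_
      have := num_scalar m y X ((N-1-r)/a) hm hm2 hq2 hX2 n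
      simpa using this
    have hAs := Finset.sum_le_sum hA
    have hBs := Finset.sum_le_sum hB
    rw [Finset.sum_const, Finset.card_range, nsmul_eq_mul] at hAs hBs
    have hfin : (a:ℝ) * (4 * n * Real.exp (-X)) ≤ 6 * τ * L * (4 * n * Real.exp (-X)) := by
      gcongr
    norm_num at hAs hBs ⊢
    linarith

lemma main_all (hn : 0 < n) (hP : RowStochastic P) (hPe : Ergodic' P) (hpiv : IsStationary P piv)
    (hpi0 : IsProbVec pi0)
    (pimax pimin : ℝ) (hpimax : pimax = ⨆ i, piv i) (hpimin : pimin = ⨅ i, piv i)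
    (τ : ℝ) (hτ : τ = (mixingTime P piv (1/4) : ℝ))
    (ε εt : ℝ) (hε : 0 < ε) (hεt : εt = min (pimin / 2) ε) :
    1 - 24 * n * τ * Real.log εt⁻¹ *
        Real.exp (-(N : ℝ) / (100 * τ * pimax * Real.log εt⁻¹ * εt⁻¹ ^ 2))
      ≤ pathProb N P pi0 {x | spec (empMatrix x - P) ≤ 4 * pimin⁻¹ * spec P * ε} := by
  have : Nonempty (Fin n) := ⟨⟨0, hn⟩⟩
  have hmle : ∀ i, pimin ≤ piv i := fun i => hpimin ▸ ciInf_le (Set.finite_range piv).bddBelow i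
  have hMge : ∀ i, piv i ≤ pimax := fun i => hpimax ▸ le_ciSup (Set.finite_range piv).bddAbove i
  have hm : 0 < pimin := by
    obtain ⟨i, hi⟩ := exists_eq_ciInf_of_finite (f := piv)
    rw [hpimin, ← hi]
    exact piv_pos hPe hpiv i
  have hsp := spec_ge_one hn P hP
  have he0 : 0 < εt := by rw [hεt]; exact lt_min (by linarith) hε
  rcases Nat.lt_or_ge n 2 with h2 | h2
  · have h1 : n = 1 := by omega
    subst h1
    have hτ0 : τ = 0 := by
      rw [hτ]
      norm_cast
      unfold mixingTime
      rw [Nat.sInf_eq_zero]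
      left
      intro i
      have hp : piv 0 = 1 := by have := hpiv.1.2; simpa using this
      have hi : i = 0 := Subsingleton.elim _ _
      subst hi
      simp [hp]
    have hall : ∀ x : Fin (N+1) → Fin 1, spec (empMatrix x - P) ≤ 4 * pimin⁻¹ * spec P * ε := by
      intro x
      have hP0 : ∀ i j, P i j = 1 := by
        intro i j
        have := hP.2 i
        rw [Subsingleton.elim j 0]
        simpa using this
      have : empMatrix x - P = 0 := by
        ext i j
        have hct : countTrans x i j = countState x i := by
          unfold countTrans countState
          congr 1
          ext t
          simp [Subsingleton.elim (x t.succ) j]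
        rw [Matrix.sub_apply, hP0]
        simp only [empMatrix, Matrix.of_apply, hct]
        split_ifs with h
        · simp
        · simp [h]
      rw [this]
      have hpos : 0 ≤ 4 * pimin⁻¹ * spec P * ε := by positivity
      refine csSup_le ⟨_, 0, by simp [l2], rfl⟩ ?_
      rintro c ⟨w, hw, rfl⟩
      simpa [l2] using hpos
    have hpp : pathProb N P pi0 {x | spec (empMatrix x - P) ≤ 4 * pimin⁻¹ * spec P * ε} = 1 := by
      rw [← Ex_const hP hpi0 N 1]
      unfold pathProb Ex
      refine Finset.sum_congr rfl fun x _ => ?_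
      rw [Set.indicator_of_mem (by exact hall x), mul_one]
    rw [hpp, hτ0]
    simp
  · refine main_ge2 h2 hP hPe hpiv hpi0 pimax pimin hm hmle hMge ?_ τ hτ εt _ he0
      (by rw [hεt]; exact min_le_left _ _) ?_
    · have h3 : ∑ i : Fin n, pimin ≤ 1 := by
        rw [← hpiv.1.2]; exact Finset.sum_le_sum fun i _ => hmle i
      rw [Finset.sum_const, Finset.card_univ, Fintype.card_fin, nsmul_eq_mul] at h3
      have : (2:ℝ) ≤ n := by exact_mod_cast h2
      nlinarith
    · have h4 : εt ≤ ε := by rw [hεt]; exact min_le_right _ _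
      have h5 : εt ≤ spec P * ε := by nlinarith
      calc 4 * pimin⁻¹ * εt ≤ 4 * pimin⁻¹ * (spec P * ε) := by gcongr
        _ = _ := by ring

end fin
end MJaux

open MJ in
/-- concentration of the empirical transition matrix. -/
theorem stmt9 {n N : ℕ} (hn : 0 < n)
    (P : Matrix (Fin n) (Fin n) ℝ) (piv pi0 : Fin n → ℝ)
    (hP : RowStochastic P) (hPe : Ergodic' P) (hpiv : IsStationary P piv)
    (hpi0 : IsProbVec pi0)
    (pimax pimin : ℝ) (hpimax : pimax = ⨆ i, piv i) (hpimin : pimin = ⨅ i, piv i)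
    (τ : ℝ) (hτ : τ = (mixingTime P piv (1/4) : ℝ))
    (ε εt : ℝ) (hε : 0 < ε) (hεt : εt = min (pimin / 2) ε) :
    1 - 24 * n * τ * Real.log εt⁻¹ *
        Real.exp (-(N : ℝ) / (100 * τ * pimax * Real.log εt⁻¹ * εt⁻¹ ^ 2))
      ≤ pathProb N P pi0 {x | spec (empMatrix x - P) ≤ 4 * pimin⁻¹ * spec P * ε} := by
  exact MJaux.main_all hn hP hPe hpiv hpi0 pimax pimin hpimax hpimin τ hτ ε εt hε hεt
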